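/- Let c' ≺ c be two distinct co-periodic comajors that are both leaves of a cubic symmetric lamination L. Then there is no finite gap H of L such that both c and c' are edges of H. -/

import Mathlib

noncomputable section

open Set Metric

instance : Fact ((0:ℝ) < 1) := ⟨one_pos⟩

/-- The circle `S = ℝ/ℤ`. -/
abbrev S1 : Type := AddCircle (1 : ℝ)

/-- The tripling map `σ₃ : x ↦ 3x (mod 1)`. -/
def s3 : S1 → S1 := fun x => (3 : ℕ) • x

/-- The antipodal map `x ↦ x + 1/2` (denoted `−x` in the paper). -/
def antip : S1 → S1 := fun x => x + (((1:ℝ)/2 : ℝ) : S1)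

/-- A chord of the circle: an unordered pair of points of `S1`. -/
abbrev Chord : Type := Sym2 S1

/-- The image chord of a chord under a circle map. -/
def cmap (f : S1 → S1) (ℓ : Chord) : Chord := Sym2.map f ℓ

/-- The length of a chord `{a,b}`: the shorter of the two arcs joining `a` and `b`
(the natural norm on `ℝ/ℤ`). -/
def chordLen : Chord → ℝ :=
  Sym2.lift ⟨fun a b => ‖a - b‖, fun a b => norm_sub_rev a b⟩

/-- The standard embedding of the circle `ℝ/ℤ` into `ℂ` (onto the unit circle). -/
def toC (x : S1) : ℂ :=
  Complex.exp (2 * Real.pi * Complex.I * (((AddCircle.equivIco 1 0 x : Set.Ico (0:ℝ) (0+1)) : ℝ) : ℂ))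

/-- The geometric chord in the closed unit disk of `ℂ` determined by an
unordered pair of circle points. -/
def chordSet : Chord → Set ℂ :=
  Sym2.lift ⟨fun a b => segment ℝ (toC a) (toC b), fun a b => segment_symm ℝ _ _⟩

/-- Two chords cross if their endpoints strictly alternate on the circle. -/
def Crosses (ℓ₁ ℓ₂ : Chord) : Prop :=
  (∃ a b c d : ℝ, a < b ∧ b < c ∧ c < d ∧ d < a + 1 ∧
    ℓ₁ = s(((a : ℝ) : S1), ((c : ℝ) : S1)) ∧ ℓ₂ = s(((b : ℝ) : S1), ((d : ℝ) : S1))) ∨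
  (∃ a b c d : ℝ, a < b ∧ b < c ∧ c < d ∧ d < a + 1 ∧
    ℓ₂ = s(((a : ℝ) : S1), ((c : ℝ) : S1)) ∧ ℓ₁ = s(((b : ℝ) : S1), ((d : ℝ) : S1)))

/-- A critical chord: nondegenerate with degenerate `σ₃`-image. -/
def IsCritical (ℓ : Chord) : Prop := ¬ ℓ.IsDiag ∧ (cmap s3 ℓ).IsDiag

/-- The union in `ℂ` of all the chords of a family. -/
def unionSet (L : Set Chord) : Set ℂ := ⋃ ℓ ∈ L, chordSet ℓ

def openDisk : Set ℂ := Metric.ball (0:ℂ) 1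
def closedDisk : Set ℂ := Metric.closedBall (0:ℂ) 1

/-- A lamination: a family of pairwise non-crossing chords whose union is closed. -/
structure IsLamination (L : Set Chord) : Prop where
  nocross : ∀ ℓ₁ ∈ L, ∀ ℓ₂ ∈ L, ¬ Crosses ℓ₁ ℓ₂
  closed : IsClosed (unionSet L)

/-- A sibling collection: three pairwise disjoint chords with the same
nondegenerate `σ₃`-image. -/
def IsSiblingCollection (ℓ₁ ℓ₂ ℓ₃ : Chord) : Prop :=
  Disjoint (chordSet ℓ₁) (chordSet ℓ₂) ∧ Disjoint (chordSet ℓ₁) (chordSet ℓ₃) ∧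
  Disjoint (chordSet ℓ₂) (chordSet ℓ₃) ∧
  ¬ (cmap s3 ℓ₁).IsDiag ∧ cmap s3 ℓ₂ = cmap s3 ℓ₁ ∧ cmap s3 ℓ₃ = cmap s3 ℓ₁

/-- A `σ₃`-invariant lamination. -/
structure IsInvLam (L : Set Chord) extends IsLamination L : Prop where
  forward : ∀ ℓ ∈ L, cmap s3 ℓ ∈ L ∨ (cmap s3 ℓ).IsDiag
  backward : ∀ ℓ ∈ L, ∃ ℓ' ∈ L, cmap s3 ℓ' = ℓ
  siblings : ∀ ℓ ∈ L, ¬ (cmap s3 ℓ).IsDiag →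
    ∃ ℓ₂ ∈ L, ∃ ℓ₃ ∈ L, IsSiblingCollection ℓ ℓ₂ ℓ₃

/-- A cubic symmetric lamination. -/
structure IsCubicSymLam (L : Set Chord) extends IsInvLam L : Prop where
  symm : ∀ ℓ ∈ L, cmap antip ℓ ∈ L

/-- A major: a leaf whose length is closest to `1/3` among all leaves. -/
def IsMajor (L : Set Chord) (M : Chord) : Prop :=
  M ∈ L ∧ ∀ ℓ ∈ L, |1/3 - chordLen M| ≤ |1/3 - chordLen ℓ|

/-- A minor: the `σ₃`-image of a major. -/
def IsMinor (L : Set Chord) (m : Chord) : Prop := ∃ M, IsMajor L M ∧ m = cmap s3 M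

/-- A comajor: a short (or degenerate) sibling of a major, disjoint from all majors. -/
def IsComajor (L : Set Chord) (c : Chord) : Prop :=
  (chordLen c < 1/6 ∨ c.IsDiag) ∧ (¬ c.IsDiag → c ∈ L) ∧
  (∃ M, IsMajor L M ∧ cmap s3 c = cmap s3 M) ∧
  (∀ M, IsMajor L M → Disjoint (chordSet c) (chordSet M))

/-- The cubic symmetric comajor lamination: all comajors of all cubic symmetric
laminations. -/
def CsCL : Set Chord := {c | ∃ L, IsCubicSymLam L ∧ IsComajor L c}

/-- A chord is periodic if some positive iterate of `σ₃` fixes it. -/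
def ChordPeriodic (c : Chord) : Prop := ∃ p, 1 ≤ p ∧ cmap (s3^[p]) c = c

/-- A comajor is co-periodic if its image is periodic but it is not. -/
def CoPeriodic (c : Chord) : Prop := ChordPeriodic (cmap s3 c) ∧ ¬ ChordPeriodic c

/-- The point of the unit circle in `ℂ` with argument `2πt`. -/
def circPt (t : ℝ) : ℂ := toC ((t : ℝ) : S1)

/-- The (closed) arc of the circle in `ℂ` from angle `u` to angle `v` (traversed
positively), as a subset of `ℂ`. -/
def arcSet (u v : ℝ) : Set ℂ := circPt '' Set.Icc u v

/-- The unordered arc between angles `u` and `v`. -/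
def arcSetU (u v : ℝ) : Set ℂ := circPt '' Set.uIcc u v

/-- The closed region `R(n)` bounded by the chord from angle `a` to angle `a+t`
(with `t` the length of the chord) and the corresponding (shorter) arc `H(n)`:
the convex hull of that arc. -/
def regionUnder (a t : ℝ) : Set ℂ := convexHull ℝ (arcSet a (a + t))

/-- `Under m n` (`m ≺ n`): `m` is contained in the region `R(n)`. -/
def Under (m n : Chord) : Prop :=
  ∃ a t : ℝ, 0 ≤ t ∧ t < 1/2 ∧ t = chordLen n ∧
    n = s(((a : ℝ) : S1), ((a + t : ℝ) : S1)) ∧ chordSet m ⊆ regionUnder a t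

/-- The (closed) strip `C(ℓ)` between the medium/long chord `ℓ` from angle `a` to
angle `a+t` (with `1/6 < t ≤ 1/2` its length) and its medium/long sibling
`ℓ' = {a+1/3, a+t-1/3}`. -/
def stripSet (a t : ℝ) : Set ℂ :=
  convexHull ℝ (arcSetU (a + t) (a + 1/3) ∪ arcSetU (a + t - 1/3) a)

/-- The short strips `SH(ℓ) = C(ℓ) ∪ −C(ℓ)`. -/
def SHSet (a t : ℝ) : Set ℂ := stripSet a t ∪ stripSet (a + 1/2) t

/-- For a short chord `c` from angle `a` to angle `a+t` (`0 ≤ t < 1/6`), the strip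
`C(M_c)` between the two medium/long chords `M_c = {a+2/3, a+t+1/3}` and
`M'_c = {a+1/3, a+t+2/3}` having the same `σ₃`-image as `c`. -/
def QStrip (a t : ℝ) : Set ℂ :=
  convexHull ℝ (arcSet (a + 1/3) (a + t + 1/3) ∪ arcSet (a + 2/3) (a + t + 2/3))

/-- A legal (symmetric) pair `{c, −c}`. -/
def IsLegalPair (c : Chord) : Prop :=
  c.IsDiag ∨
  ∃ a t : ℝ, 0 < t ∧ t < 1/6 ∧ t = chordLen c ∧
    c = s(((a : ℝ) : S1), ((a + t : ℝ) : S1)) ∧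
    (∀ i j : ℕ,
      ¬ Crosses (cmap (s3^[i]) c) (cmap (s3^[j]) c) ∧
      ¬ Crosses (cmap (s3^[i]) c) (cmap (s3^[j]) (cmap antip c)) ∧
      ¬ Crosses (cmap (s3^[i]) (cmap antip c)) (cmap (s3^[j]) (cmap antip c))) ∧
    (∀ i : ℕ, 1 ≤ i →
      chordSet (cmap (s3^[i]) c) ∩ interior (QStrip a t ∪ QStrip (a + 1/2) t) = ∅)

/-- A gap of a lamination: the closure of a connected component of the complement,
in the open unit disk, of the union of the leaves. -/
def IsGapOf (L : Set Chord) (G : Set ℂ) : Prop :=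
  ∃ z ∈ openDisk \ unionSet L, G = closure (connectedComponentIn (openDisk \ unionSet L) z)

/-- The vertices of a gap: its points on the circle. -/
def gapVerts (G : Set ℂ) : Set S1 := {x : S1 | toC x ∈ G}

/-- The image of a gap: the convex hull of the `σ₃`-image of its vertex set. -/
def gapImage (G : Set ℂ) : Set ℂ := convexHull ℝ (toC '' (s3 '' gapVerts G))

/-- Iterated gap images. -/
def gapIter (n : ℕ) (G : Set ℂ) : Set ℂ := gapImage^[n] G

/-- An edge of a gap: a nondegenerate chord contained in its boundary. -/
def IsEdgeOf (G : Set ℂ) (ℓ : Chord) : Prop := ¬ ℓ.IsDiag ∧ chordSet ℓ ⊆ frontier G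

/-- The (first return) map `σ₃^p` on the gap `G` has degree greater than one:
some edge of the image gap has (at least) two disjoint preimage edges in `G`. -/
def GapDegreeGE2 (G : Set ℂ) (p : ℕ) : Prop :=
  ∃ m e₁ e₂ : Chord, IsEdgeOf (gapIter p G) m ∧ e₁ ≠ e₂ ∧
    IsEdgeOf G e₁ ∧ IsEdgeOf G e₂ ∧ Disjoint (chordSet e₁) (chordSet e₂) ∧
    cmap (s3^[p]) e₁ = m ∧ cmap (s3^[p]) e₂ = m

/-- `L` has a periodic infinite gap of degree greater than one (hyperbolicity). -/
def HasHyperbolicGap (L : Set Chord) : Prop :=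
  ∃ G p, IsGapOf L G ∧ (gapVerts G).Infinite ∧ 1 ≤ p ∧ gapIter p G = G ∧ GapDegreeGE2 G p

/-- Two circle points are joined by a finite concatenation of leaves of `L`. -/
def ChainJoined (L : Set Chord) : S1 → S1 → Prop :=
  Relation.ReflTransGen (fun x y => ∃ ℓ ∈ L, x ∈ ℓ ∧ y ∈ ℓ)

/-- A q-lamination: points joined by finite concatenations of leaves are vertices of
a single leaf or finite gap. -/
def IsQLam (L : Set Chord) : Prop :=
  ∀ x y : S1, ChainJoined L x y →
    x = y ∨ (∃ ℓ ∈ L, x ∈ ℓ ∧ y ∈ ℓ) ∨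
    (∃ G, IsGapOf L G ∧ (gapVerts G).Finite ∧ toC x ∈ G ∧ toC y ∈ G)

/-- A periodic point of `σ₃`. -/
def PerPt (x : S1) : Prop := ∃ p, 1 ≤ p ∧ s3^[p] x = x

/-- An eventually periodic point of `σ₃`. -/
def EvPerPt (x : S1) : Prop := ∃ k, PerPt (s3^[k] x)

/-- `x` is strictly preperiodic of preperiod `k ≥ 1` and period `p`. -/
def StrictPreper (x : S1) (k p : ℕ) : Prop :=
  1 ≤ k ∧ 1 ≤ p ∧ s3^[p] (s3^[k] x) = s3^[k] x ∧
  (∀ j < k, ¬ PerPt (s3^[j] x)) ∧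
  (∀ q, 1 ≤ q → s3^[q] (s3^[k] x) = s3^[k] x → p ≤ q)

/-- A periodic point of type B: of period `2n` with `σ₃ⁿ(x) = −x`. -/
def TypeB (x : S1) : Prop :=
  ∃ n, 1 ≤ n ∧ Function.minimalPeriod s3 x = 2 * n ∧ s3^[n] x = antip x

/-- `c` is a two-sided limit of chords of the family `A`: within every complementary
component of the disk minus `c` there are chords of `A` converging to `c`. -/
def TwoSidedLimitOf (A : Set Chord) (c : Chord) : Prop :=
  ∀ z ∈ closedDisk \ chordSet c, ∀ ε : ℝ, 0 < ε →
    ∃ d ∈ A, d ≠ c ∧ chordSet d ⊆ connectedComponentIn (closedDisk \ chordSet c) z ∧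
      Metric.hausdorffDist (chordSet d) (chordSet c) < ε

/-- The chord `n` weakly separates the chords `ℓ₁` and `ℓ₂`. -/
def WeaklySep (n ℓ₁ ℓ₂ : Chord) : Prop :=
  ∃ z₁ ∈ chordSet ℓ₁ \ chordSet n, ∃ z₂ ∈ chordSet ℓ₂ \ chordSet n,
    chordSet ℓ₁ \ chordSet n ⊆ connectedComponentIn (closedDisk \ chordSet n) z₁ ∧
    chordSet ℓ₂ \ chordSet n ⊆ connectedComponentIn (closedDisk \ chordSet n) z₂ ∧
    connectedComponentIn (closedDisk \ chordSet n) z₁ ≠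
      connectedComponentIn (closedDisk \ chordSet n) z₂

/-- The (non-diameter, non-fixed) chord `ℓ` moves in under the circle map `h`. -/
def MovesIn (h : S1 → S1) (ℓ : Chord) : Prop := cmap h ℓ ≠ ℓ ∧ Under (cmap h ℓ) ℓ

/-- The chord `ℓ` moves out under the circle map `h`. -/
def MovesOut (h : S1 → S1) (ℓ : Chord) : Prop := cmap h ℓ ≠ ℓ ∧ ¬ Under (cmap h ℓ) ℓ

/-- The length of the positively oriented arc from `x` to `y`, a number in `[0, 1)`. -/
def posArc (x y : S1) : ℝ := ((AddCircle.equivIco 1 0 (y - x) : Set.Ico (0:ℝ) (0+1)) : ℝ)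

theorem posArc_coe (a b : ℝ) : posArc (a : S1) (b : S1) = Int.fract (b - a) := by
  unfold posArc
  rw [← AddCircle.coe_sub, AddCircle.coe_equivIco_mk_apply]
  simp

theorem posArc_nonneg (x y : S1) : 0 ≤ posArc x y :=
  (AddCircle.equivIco 1 0 (y - x)).2.1

theorem posArc_lt_one (x y : S1) : posArc x y < 1 := by
  have := (AddCircle.equivIco 1 0 (y - x)).2.2
  simpa [posArc] using this

theorem exists_coe_eq (x : S1) : ∃ a : ℝ, (a : S1) = x := by
  induction x using QuotientAddGroup.induction_on with
  | H a => exact ⟨a, rfl⟩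

theorem coe_add_int (a : ℝ) (n : ℤ) : ((a + n : ℝ) : S1) = (a : S1) := by
  have h : ((n : ℝ) : S1) = 0 := by
    rw [AddCircle.coe_eq_zero_iff]
    exact ⟨n, by simp⟩
  rw [AddCircle.coe_add, h, add_zero]

theorem coe_fract (a : ℝ) : ((Int.fract a : ℝ) : S1) = (a : S1) := by
  have := coe_add_int (Int.fract a) ⌊a⌋
  rw [Int.fract_add_floor] at this
  exact this.symm

theorem coe_add_one (a : ℝ) : ((a + 1 : ℝ) : S1) = (a : S1) := by
  exact_mod_cast coe_add_int a 1

theorem add_posArc (x y : S1) : x + ((posArc x y : ℝ) : S1) = y := by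
  obtain ⟨a, rfl⟩ := exists_coe_eq x
  obtain ⟨b, rfl⟩ := exists_coe_eq y
  rw [posArc_coe, coe_fract, ← AddCircle.coe_add, add_sub_cancel]

theorem posArc_add_coe (x : S1) (r : ℝ) : posArc x (x + (r : S1)) = Int.fract r := by
  obtain ⟨a, rfl⟩ := exists_coe_eq x
  rw [← AddCircle.coe_add, posArc_coe, add_sub_cancel_left]

theorem posArc_add_coe_add_coe (x : S1) (r s : ℝ) :
    posArc (x + (r : S1)) (x + (s : S1)) = Int.fract (s - r) := by
  obtain ⟨a, rfl⟩ := exists_coe_eq x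
  rw [← AddCircle.coe_add, ← AddCircle.coe_add, posArc_coe, add_sub_add_left_eq_sub]

theorem posArc_add_right (x y z : S1) : posArc (x + z) (y + z) = posArc x y := by
  unfold posArc
  rw [add_sub_add_right_eq_sub]

theorem posArc_self (x : S1) : posArc x x = 0 := by
  obtain ⟨a, rfl⟩ := exists_coe_eq x
  simp [posArc_coe]

theorem posArc_eq_zero {x y : S1} : posArc x y = 0 ↔ x = y := by
  constructor
  · intro h
    have := add_posArc x y
    rw [h] at this
    simpa using this
  · rintro rfl
    exact posArc_self x

theorem posArc_pos {x y : S1} : 0 < posArc x y ↔ x ≠ y := by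
  rw [Ne, ← posArc_eq_zero]
  exact ⟨fun h => h.ne', fun h => lt_of_le_of_ne (posArc_nonneg x y) (Ne.symm h)⟩

theorem eq_of_posArc_eq {u x y : S1} (h : posArc u x = posArc u y) : x = y := by
  rw [← add_posArc u x, h, add_posArc]

theorem posArc_of_le {u x y : S1} (h : posArc u x ≤ posArc u y) :
    posArc x y = posArc u y - posArc u x := by
  conv_lhs => rw [← add_posArc u x, ← add_posArc u y, posArc_add_coe_add_coe]
  rw [Int.fract_eq_self]
  have := posArc_nonneg u x
  have := posArc_lt_one u y
  constructor <;> linarith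

theorem posArc_of_lt {u x y : S1} (h : posArc u y < posArc u x) :
    posArc x y = posArc u y - posArc u x + 1 := by
  conv_lhs => rw [← add_posArc u x, ← add_posArc u y, posArc_add_coe_add_coe]
  rw [Int.fract_eq_iff]
  have := posArc_nonneg u y
  have := posArc_lt_one u x
  refine ⟨by linarith, by linarith, -1, by push_cast; ring⟩

theorem posArc_swap {x y : S1} (h : x ≠ y) : posArc y x = 1 - posArc x y := by
  have h1 := posArc_pos.2 h
  have := posArc_of_lt (u := x) (x := y) (y := x) (by rwa [posArc_self])
  rw [this, posArc_self]; ring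

theorem s3_coe (a : ℝ) : s3 (a : S1) = ((3 * a : ℝ) : S1) := by
  unfold s3
  rw [← AddCircle.coe_nsmul]
  simp

theorem s3_add (x y : S1) : s3 (x + y) = s3 x + s3 y := by
  unfold s3
  rw [nsmul_add]

theorem posArc_s3 (u x : S1) : posArc (s3 u) (s3 x) = Int.fract (3 * posArc u x) := by
  conv_lhs => rw [← add_posArc u x, s3_add, s3_coe, posArc_add_coe]

theorem posArc_antip (u x : S1) : posArc (antip u) (antip x) = posArc u x :=
  posArc_add_right _ _ _

theorem antip_antip (x : S1) : antip (antip x) = x := by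
  unfold antip
  rw [add_assoc, ← AddCircle.coe_add]
  norm_num

theorem s3_antip (x : S1) : s3 (antip x) = antip (s3 x) := by
  unfold antip
  rw [s3_add, s3_coe]
  congr 1
  rw [← coe_add_one (1/2)]
  norm_num

/-- The points `x` and `y` are not separated by any leaf of `L`. -/
def Unsep (L : Set Chord) (x y : S1) : Prop :=
  ∀ u v : S1, s(u, v) ∈ L →
    ¬ (0 < posArc u x ∧ posArc u x < posArc u v ∧ posArc u v < posArc u y)

/-- Two leaves of a lamination do not cross, in terms of real representatives. -/
theorem IsLamination.not_mem_of_lt {L : Set Chord} (hL : IsLamination L) {a b c d : ℝ}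
    (hab : a < b) (hbc : b < c) (hcd : c < d) (hda : d < a + 1)
    (h1 : s((a : S1), (c : S1)) ∈ L) (h2 : s((b : S1), (d : S1)) ∈ L) : False :=
  hL.nocross _ h1 _ h2 (Or.inl ⟨a, b, c, d, hab, hbc, hcd, hda, rfl, rfl⟩)

/-- The point `1/3` of the circle. -/
def third : S1 := ((1/3 : ℝ) : S1)

theorem add_third_three (x : S1) : x + third + third + third = x := by
  obtain ⟨a, rfl⟩ := exists_coe_eq x
  unfold third
  rw [← AddCircle.coe_add, ← AddCircle.coe_add, ← AddCircle.coe_add, ← coe_add_one a]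
  congr 1; ring

theorem coe_add_third (a : ℝ) : (a : S1) + third = ((a + 1/3 : ℝ) : S1) := by
  rw [AddCircle.coe_add]; rfl

theorem coe_add_third_add_third (a : ℝ) : (a : S1) + third + third = ((a + 2/3 : ℝ) : S1) := by
  rw [coe_add_third, coe_add_third]; congr 1; ring

theorem eq_or_of_s3_eq {x y : S1} (h : s3 x = s3 y) :
    y = x ∨ y = x + third ∨ y = x + third + third := by
  have h1 : Int.fract (3 * posArc x y) = 0 := by
    rw [← posArc_s3, h, posArc_self]
  have h0 := posArc_nonneg x y
  have h2 := posArc_lt_one x y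
  rw [Int.fract_eq_iff] at h1
  obtain ⟨-, -, k, hk⟩ := h1
  have hk0 : (0:ℝ) ≤ k := by linarith
  have hk3 : (k:ℝ) < 3 := by linarith
  have hk0' : 0 ≤ k := by exact_mod_cast hk0
  have hk3' : k < 3 := by exact_mod_cast hk3
  have hxy := add_posArc x y
  obtain ⟨a, rfl⟩ := exists_coe_eq x
  interval_cases k
  · left
    have : posArc (a : S1) y = 0 := by push_cast at hk; linarith
    rw [← hxy, this]; simp
  · right; left
    have : posArc (a : S1) y = 1/3 := by push_cast at hk; linarith
    rw [← hxy, this]; rfl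
  · right; right
    have : posArc (a : S1) y = 2/3 := by push_cast at hk; linarith
    rw [← hxy, this, coe_add_third_add_third, AddCircle.coe_add]

theorem exists_rep_of_cmap_eq {ℓ : Chord} {u v : S1} (h : cmap s3 ℓ = s(s3 u, s3 v)) :
    ∃ p q, ℓ = s(p, q) ∧ s3 u = s3 p ∧ s3 v = s3 q := by
  induction ℓ using Sym2.ind with
  | _ p q =>
  unfold cmap at h
  rw [Sym2.map_mk, Sym2.eq_iff] at h
  rcases h with ⟨h1, h2⟩ | ⟨h1, h2⟩
  · exact ⟨p, q, rfl, h1.symm, h2.symm⟩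
  · exact ⟨q, p, Sym2.eq_swap, h2.symm, h1.symm⟩

theorem ne_of_disjoint_chordSet {p q u v : S1}
    (h : Disjoint (chordSet s(p, q)) (chordSet s(u, v))) : p ≠ u ∧ q ≠ v := by
  rw [Set.disjoint_left] at h
  constructor
  · rintro rfl
    exact h (left_mem_segment ℝ _ _) (left_mem_segment ℝ _ _)
  · rintro rfl
    exact h (right_mem_segment ℝ _ _) (right_mem_segment ℝ _ _)

theorem IsInvLam.sibling_leaves {L : Set Chord} (hL : IsInvLam L) {u v : S1}
    (h : s(u, v) ∈ L) (hne : s3 u ≠ s3 v) :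
    (s(u + third, v + third) ∈ L ∧ s(u + third + third, v + third + third) ∈ L) ∨
    (s(u + third, v + third + third) ∈ L ∧ s(u + third + third, v + third) ∈ L) := by
  have hd : ¬ (cmap s3 s(u, v)).IsDiag := by
    unfold cmap
    rw [Sym2.map_mk, Sym2.mk_isDiag_iff]
    exact hne
  obtain ⟨ℓ₂, h2, ℓ₃, h3, d12, d13, d23, -, e2, e3⟩ := hL.siblings _ h hd
  obtain ⟨p, q, rfl, hp, hq⟩ := exists_rep_of_cmap_eq (e2.trans (Sym2.map_mk ..))
  obtain ⟨p', q', rfl, hp', hq'⟩ := exists_rep_of_cmap_eq (e3.trans (Sym2.map_mk ..))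
  have := ne_of_disjoint_chordSet d12
  have := ne_of_disjoint_chordSet d13
  have := ne_of_disjoint_chordSet d23
  rcases eq_or_of_s3_eq hp with rfl | rfl | rfl <;> rcases eq_or_of_s3_eq hq with rfl | rfl | rfl
    <;> rcases eq_or_of_s3_eq hp' with rfl | rfl | rfl <;>
    rcases eq_or_of_s3_eq hq' with rfl | rfl | rfl <;> tauto

theorem IsInvLam.preimage_leaves {L : Set Chord} (hL : IsInvLam L) {A B : S1}
    (h : s(s3 A, s3 B) ∈ L) (hne : s3 A ≠ s3 B) :
    (s(A, B) ∈ L ∧ s(A + third, B + third) ∈ L ∧ s(A + third + third, B + third + third) ∈ L) ∨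
    (s(A, B) ∈ L ∧ s(A + third, B + third + third) ∈ L ∧ s(A + third + third, B + third) ∈ L) ∨
    (s(A, B + third) ∈ L ∧ s(A + third, B + third + third) ∈ L ∧ s(A + third + third, B) ∈ L) ∨
    (s(A, B + third) ∈ L ∧ s(A + third, B) ∈ L ∧ s(A + third + third, B + third + third) ∈ L) ∨
    (s(A, B + third + third) ∈ L ∧ s(A + third, B) ∈ L ∧ s(A + third + third, B + third) ∈ L) ∨
    (s(A, B + third + third) ∈ L ∧ s(A + third, B + third) ∈ L ∧
      s(A + third + third, B) ∈ L) := by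
  obtain ⟨ℓ, hℓ, e⟩ := hL.backward _ h
  obtain ⟨p, q, rfl, hp, hq⟩ := exists_rep_of_cmap_eq e
  have h1 := hL.sibling_leaves hℓ (by rwa [← hp, ← hq])
  rcases eq_or_of_s3_eq hp with rfl | rfl | rfl <;> rcases eq_or_of_s3_eq hq with rfl | rfl | rfl
    <;>
    (try simp only [add_third_three] at h1) <;> rcases h1 with ⟨h1, h2⟩ | ⟨h1, h2⟩ <;>
    simp only [hℓ, h1, h2, true_and, true_or, or_true]

theorem Unsep.not_mem_of_lt {L : Set Chord} {a x b y : ℝ} (h : Unsep L (x : S1) (y : S1))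
    (hax : a < x) (hxb : x < b) (hby : b < y) (hya : y < a + 1)
    (hab : s((a : S1), (b : S1)) ∈ L) : False := by
  refine h _ _ hab ?_
  rw [posArc_coe, posArc_coe, posArc_coe, Int.fract_eq_self.2 ⟨by linarith, by linarith⟩,
    Int.fract_eq_self.2 ⟨by linarith, by linarith⟩, Int.fract_eq_self.2 ⟨by linarith, by linarith⟩]
  exact ⟨by linarith, by linarith, by linarith⟩

theorem IsInvLam.unsep_s3 {L : Set Chord} (hL : IsInvLam L) {x y : S1} (h : Unsep L x y) :
    Unsep L (s3 x) (s3 y) := by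
  intro U V hUV ⟨h1, h2, h3⟩
  have hy1 := posArc_lt_one U (s3 y)
  obtain ⟨x, rfl⟩ := exists_coe_eq x
  set ξ := posArc U (s3 x) / 3 with hξ
  set β := posArc U V / 3 with hβ
  set η := posArc U (s3 y) / 3 with hη
  set a := x - ξ with ha
  have hU : U = s3 (a : S1) := by
    apply eq_of_posArc_eq (u := s3 (x : S1))
    have hUx : U ≠ s3 x := posArc_pos.1 h1
    have hUx' := posArc_lt_one U (s3 x)
    rw [posArc_swap hUx, eq_comm]
    generalize posArc U (s3 x) = d at *
    rw [s3_coe, s3_coe, posArc_coe, Int.fract_eq_iff]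
    exact ⟨by linarith, by linarith, -1, by push_cast; linarith⟩
  have hs3 : ∀ r : ℝ, 0 ≤ r → r < 1/3 → posArc U (s3 ((a + r : ℝ) : S1)) = 3 * r := by
    intro r hr0 hr1
    rw [hU, s3_coe, s3_coe, posArc_coe, Int.fract_eq_iff]
    exact ⟨by linarith, by linarith, 0, by push_cast; ring⟩
  have hV : V = s3 ((a + β : ℝ) : S1) := by
    apply eq_of_posArc_eq (u := U)
    rw [hs3 _ (by linarith) (by linarith)]; linarith
  have hY : s3 ((a + η : ℝ) : S1) = s3 y := by
    apply eq_of_posArc_eq (u := U)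
    rw [hs3 _ (by linarith) (by linarith)]; linarith
  have hx : x = a + ξ := by linarith
  rw [hx] at h
  have hne : s3 (a : S1) ≠ s3 ((a + β : ℝ) : S1) := by
    rw [← hU, ← hV]; exact posArc_pos.1 (by linarith)
  rw [hU, hV] at hUV
  have hp := hL.preimage_leaves hUV hne
  simp only [coe_add_third_add_third] at hp
  simp only [coe_add_third] at hp
  have hξβ : ξ < β := by linarith
  have hβη : β < η := by linarith
  have hξ0 : 0 < ξ := by linarith
  have hη0 : η < 1/3 := by linarith
  have swap : ∀ {p q : S1}, s(p, q) ∈ L → s(q, p) ∈ L := fun h => by rwa [Sym2.eq_swap]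
  have cross : ∀ {p q r : ℝ}, p < a + ξ → a + ξ < q → q < r → r < p + 1 →
      Unsep L ((a + ξ : ℝ) : S1) (r : S1) → s((p : S1), (q : S1)) ∈ L → False :=
    fun h1 h2 h3 h4 h5 h6 => h5.not_mem_of_lt h1 h2 h3 h4 h6
  have e1 : ((a + 1/3 - 1 : ℝ) : S1) = ((a + 1/3 : ℝ) : S1) := by
    rw [← coe_add_one (a + 1/3 - 1)]; congr 1; ring
  have e2 : ((a + 2/3 - 1 : ℝ) : S1) = ((a + 2/3 : ℝ) : S1) := by
    rw [← coe_add_one (a + 2/3 - 1)]; congr 1; ring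
  clear_value ξ β η a
  rcases eq_or_of_s3_eq hY with rfl | rfl | rfl
  · rcases hp with ⟨q1, q2, q3⟩ | ⟨q1, q2, q3⟩ | ⟨q1, q2, q3⟩ | ⟨q1, q2, q3⟩ | ⟨q1, q2, q3⟩ | ⟨q1, q2, q3⟩
    all_goals first
      | exact cross (p := a) (q := a + β) (by linarith) (by linarith) (by linarith) (by linarith) h q1
      | exact cross (p := a + 1/3 - 1) (q := a + β) (by linarith) (by linarith) (by linarith) (by linarith) h (by rw [e1]; exact q2)
      | exact cross (p := a + 2/3 - 1) (q := a + β) (by linarith) (by linarith) (by linarith) (by linarith) h (by rw [e2]; exact q3)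
  · rw [coe_add_third] at h
    rcases hp with ⟨q1, q2, q3⟩ | ⟨q1, q2, q3⟩ | ⟨q1, q2, q3⟩ | ⟨q1, q2, q3⟩ | ⟨q1, q2, q3⟩ | ⟨q1, q2, q3⟩
    all_goals first
      | exact cross (p := a) (q := a + β) (by linarith) (by linarith) (by linarith) (by linarith) h q1
      | exact cross (p := a) (q := a + β + 1/3) (by linarith) (by linarith) (by linarith) (by linarith) h q1
      | exact cross (p := a + 2/3 - 1) (q := a + β) (by linarith) (by linarith) (by linarith) (by linarith) h (by rw [e2]; exact q3)
      | exact cross (p := a + 2/3 - 1) (q := a + β + 1/3) (by linarith) (by linarith) (by linarith) (by linarith) h (by rw [e2]; exact q3)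
  · rw [coe_add_third_add_third] at h
    rcases hp with ⟨q1, q2, q3⟩ | ⟨q1, q2, q3⟩ | ⟨q1, q2, q3⟩ | ⟨q1, q2, q3⟩ | ⟨q1, q2, q3⟩ | ⟨q1, q2, q3⟩
    all_goals exact cross (p := a) (by linarith) (by linarith) (by linarith) (by linarith) h q1

theorem IsInvLam.s3_hole {L : Set Chord} (hL : IsInvLam L) {u v z : S1} (huv : s(u, v) ∈ L)
    (hne : s3 u ≠ s3 v) (hz : Unsep L z u) (hout : ¬ (0 < posArc u z ∧ posArc u z < posArc u v)) :
    ¬ (0 < posArc (s3 u) (s3 z) ∧ posArc (s3 u) (s3 z) < posArc (s3 u) (s3 v)) := by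
  rintro ⟨h1, h2⟩
  have h3 := posArc_lt_one (s3 u) (s3 v)
  obtain ⟨a, rfl⟩ := exists_coe_eq u
  set β := posArc (s3 (a : S1)) (s3 v) / 3 with hβ
  set ζ := posArc (s3 (a : S1)) (s3 z) / 3 with hζ
  have hs3 : ∀ r : ℝ, 0 ≤ r → r < 1/3 → posArc (s3 (a : S1)) (s3 ((a + r : ℝ) : S1)) = 3 * r := by
    intro r hr0 hr1
    rw [s3_coe, s3_coe, posArc_coe, Int.fract_eq_iff]
    exact ⟨by linarith, by linarith, 0, by push_cast; ring⟩
  have hV : s3 ((a + β : ℝ) : S1) = s3 v := by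
    apply eq_of_posArc_eq (u := s3 (a : S1))
    rw [hs3 _ (by linarith) (by linarith)]; linarith
  have hZ : s3 ((a + ζ : ℝ) : S1) = s3 z := by
    apply eq_of_posArc_eq (u := s3 (a : S1))
    rw [hs3 _ (by linarith) (by linarith)]; linarith
  have hζβ : ζ < β := by linarith
  have hζ0 : 0 < ζ := by linarith
  have hβ0 : β < 1/3 := by linarith
  have arc : ∀ r : ℝ, 0 ≤ r → r < 1 → posArc (a : S1) ((a + r : ℝ) : S1) = r := by
    intro r h0 h1
    rw [posArc_coe, add_sub_cancel_left, Int.fract_eq_self]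
    exact ⟨h0, h1⟩
  have cross : ∀ {p q r : ℝ}, p < r → r < q → q < a + 1 → a < p →
      Unsep L (r : S1) (a : S1) → s((p : S1), (q : S1)) ∈ L → False := by
    intro p q r h1 h2 h3 h4 h5 h6
    rw [← coe_add_one a] at h5
    exact h5.not_mem_of_lt h1 h2 h3 (by linarith) h6
  have hsib := hL.sibling_leaves huv hne
  clear_value β ζ
  rcases eq_or_of_s3_eq hV with rfl | rfl | rfl <;>
    rcases eq_or_of_s3_eq hZ with rfl | rfl | rfl <;>
    simp only [coe_add_third_add_third] at hsib hz hout <;>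
    simp only [coe_add_third] at hsib hz hout
  · rw [arc _ (by linarith) (by linarith), arc _ (by linarith) (by linarith)] at hout
    exact hout ⟨hζ0, hζβ⟩
  · rcases hsib with ⟨q1, q2⟩ | ⟨q1, q2⟩
    · exact cross (p := a + 1/3) (by linarith) (by linarith) (by linarith) (by linarith) hz q1
    · exact cross (p := a + 1/3) (by linarith) (by linarith) (by linarith) (by linarith) hz q1
  · rcases hsib with ⟨q1, q2⟩ | ⟨q1, q2⟩
    · exact cross (p := a + 2/3) (by linarith) (by linarith) (by linarith) (by linarith) hz q2
    · exact cross (p := a + 1/3) (by linarith) (by linarith) (by linarith) (by linarith) hz q1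
  · rw [add_assoc, arc _ (by linarith) (by linarith), arc _ (by linarith) (by linarith)] at hout
    exact hout ⟨hζ0, by linarith⟩
  · rw [add_assoc, add_assoc, arc _ (by linarith) (by linarith),
      arc _ (by linarith) (by linarith)] at hout
    exact hout ⟨by linarith, by linarith⟩
  · rcases hsib with ⟨q1, q2⟩ | ⟨q1, q2⟩
    · exact cross (p := a + 1/3) (q := a + β + 2/3)
        (by linarith) (by linarith) (by linarith) (by linarith) hz q1
    · exact cross (p := a + 2/3) (q := a + β + 2/3)
        (by linarith) (by linarith) (by linarith) (by linarith) hz q2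
  · rw [add_assoc, arc _ (by linarith) (by linarith), arc _ (by linarith) (by linarith)] at hout
    exact hout ⟨hζ0, by linarith⟩
  · rw [add_assoc, add_assoc, arc _ (by linarith) (by linarith),
      arc _ (by linarith) (by linarith)] at hout
    exact hout ⟨by linarith, by linarith⟩
  · rw [add_assoc, add_assoc, arc _ (by linarith) (by linarith),
      arc _ (by linarith) (by linarith)] at hout
    exact hout ⟨by linarith, by linarith⟩

/-- A cyclic sequence of mutually unseparated points whose consecutive members are equal or
joined by a leaf cutting off none of the points. -/
structure IsWeakPolygon (L : Set Chord) {r : ℕ} (w : Fin (r + 1) → S1) : Prop where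
  unsep : ∀ i j, Unsep L (w i) (w j)
  edge : ∀ i, w i = w (i + 1) ∨ s(w i, w (i + 1)) ∈ L ∧
    ∀ j, ¬ (0 < posArc (w i) (w j) ∧ posArc (w i) (w j) < posArc (w i) (w (i + 1)))

section

variable {L : Set Chord} {r : ℕ}

theorem IsWeakPolygon.s3 (hL : IsInvLam L) {w : Fin (r + 1) → S1} (hw : IsWeakPolygon L w) :
    IsWeakPolygon L (fun i => s3 (w i)) := by
  refine ⟨fun i j => hL.unsep_s3 (hw.unsep i j), fun i => ?_⟩
  by_cases h : _root_.s3 (w i) = _root_.s3 (w (i + 1))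
  · exact Or.inl h
  · right
    rcases hw.edge i with h1 | ⟨h1, h2⟩
    · exact absurd (congrArg _root_.s3 h1) h
    · constructor
      · rcases hL.forward _ h1 with h3 | h3
        · exact h3
        · unfold cmap at h3
          rw [Sym2.map_mk, Sym2.mk_isDiag_iff] at h3
          exact absurd h3 h
      · exact fun j => hL.s3_hole h1 h (hw.unsep j i) (h2 j)

theorem IsCubicSymLam.mem_antip (hL : IsCubicSymLam L) {x y : S1} (h : s(x, y) ∈ L) :
    s(antip x, antip y) ∈ L := hL.symm _ h

theorem IsCubicSymLam.unsep_antip (hL : IsCubicSymLam L) {x y : S1} (h : Unsep L x y) :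
    Unsep L (antip x) (antip y) := by
  intro u v huv h1
  refine h (antip u) (antip v) (hL.mem_antip huv) ?_
  rw [← posArc_antip, ← posArc_antip _ (antip v), ← posArc_antip _ y]
  simpa only [antip_antip] using h1

theorem IsWeakPolygon.antip (hL : IsCubicSymLam L) {w : Fin (r + 1) → S1}
    (hw : IsWeakPolygon L w) : IsWeakPolygon L (fun i => antip (w i)) := by
  refine ⟨fun i j => hL.unsep_antip (hw.unsep i j), fun i => ?_⟩
  rcases hw.edge i with h1 | ⟨h1, h2⟩
  · exact Or.inl (congrArg _ h1)
  · exact Or.inr ⟨hL.mem_antip h1, by simpa only [posArc_antip] using h2⟩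

theorem IsWeakPolygon.iterate_s3 (hL : IsInvLam L) {w : Fin (r + 1) → S1}
    (hw : IsWeakPolygon L w) (n : ℕ) : IsWeakPolygon L (fun i => _root_.s3^[n] (w i)) := by
  induction n with
  | zero => exact hw
  | succ n ih =>
    simp only [Function.iterate_succ_apply']
    exact ih.s3 hL

/-- A weak polygon with distinct vertices. -/
structure IsPolygon (L : Set Chord) (v : Fin (r + 1) → S1) : Prop extends
    IsWeakPolygon L v where
  inj : Function.Injective v

theorem Fin.add_one_ne_self (hr : 2 ≤ r) (i : Fin (r + 1)) : i + 1 ≠ i := by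
  intro h
  have h := congrArg Fin.val h
  rw [Fin.val_add_one] at h
  split_ifs at h with h1
  · subst h1; simp at h; omega
  · omega

theorem Fin.add_one_add_one_ne_self (hr : 2 ≤ r) (i : Fin (r + 1)) : i + 1 + 1 ≠ i := by
  intro h
  have h := congrArg Fin.val h
  have h2 := Fin.val_add_one i
  rw [Fin.val_add_one] at h
  split_ifs at h h2 with h1 h3 h3 <;> simp_all <;> omega

theorem IsPolygon.mem (hr : 2 ≤ r) {v : Fin (r + 1) → S1} (hv : IsPolygon L v)
    (i : Fin (r + 1)) : s(v i, v (i + 1)) ∈ L := by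
  rcases hv.edge i with h | h
  · exact absurd (hv.inj h).symm (Fin.add_one_ne_self hr i)
  · exact h.1

theorem IsPolygon.hole {v : Fin (r + 1) → S1} (hv : IsPolygon L v)
    {i j : Fin (r + 1)} (hij : j ≠ i) : posArc (v i) (v (i + 1)) ≤ posArc (v i) (v j) := by
  rcases hv.edge i with h | h
  · rw [← h, posArc_self]; exact posArc_nonneg _ _
  · have h1 := h.2 j
    by_contra h2
    exact h1 ⟨posArc_pos.2 (fun h => hij (hv.inj h.symm)), by linarith⟩

theorem IsPolygon.hole_lt {v : Fin (r + 1) → S1} (hv : IsPolygon L v)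
    {i j : Fin (r + 1)} (hij : j ≠ i) (hij' : j ≠ i + 1) :
    posArc (v i) (v (i + 1)) < posArc (v i) (v j) :=
  lt_of_le_of_ne (hv.hole hij) (fun h => hij' (hv.inj (eq_of_posArc_eq h)).symm)

theorem IsPolygon.exists_eq_of_unsep (hr : 2 ≤ r) {v : Fin (r + 1) → S1} (hv : IsPolygon L v)
    {y : S1} (hy : ∀ j, Unsep L y (v j)) : ∃ j, y = v j := by
  by_contra! hne
  obtain ⟨i, -, hi⟩ := Finset.exists_min_image Finset.univ (fun i => posArc (v i) y)
    ⟨0, Finset.mem_univ _⟩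
  have h0 : 0 < posArc (v i) y := posArc_pos.2 (hne i).symm
  have h1 : posArc (v i) y < posArc (v i) (v (i + 1)) := by
    by_contra h
    have h2 := posArc_of_le (not_lt.1 h)
    have h3 := hi (i + 1) (Finset.mem_univ _)
    have h4 : 0 < posArc (v i) (v (i + 1)) :=
      posArc_pos.2 (fun h => Fin.add_one_ne_self hr i (hv.inj h).symm)
    linarith
  have h2 := hv.hole_lt (i := i) (j := i + 1 + 1) (Fin.add_one_add_one_ne_self hr i)
    (Fin.add_one_ne_self hr _)
  exact hy _ _ _ (hv.mem hr i) ⟨h0, h1, h2⟩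

theorem IsPolygon.adjacent_of_mem (hr : 2 ≤ r) {v : Fin (r + 1) → S1} (hv : IsPolygon L v)
    {i j : Fin (r + 1)} (h : s(v i, v j) ∈ L) (hij : i ≠ j) : j = i + 1 ∨ i = j + 1 := by
  by_contra! hne
  obtain ⟨h1, h2⟩ := hne
  have h3 := hv.hole_lt hij.symm h1
  have h4 := hv.hole_lt hij h2
  have h5 : 0 < posArc (v i) (v (i + 1)) :=
    posArc_pos.2 (fun h => Fin.add_one_ne_self hr i (hv.inj h).symm)
  have h6 : 0 < posArc (v j) (v (j + 1)) :=
    posArc_pos.2 (fun h => Fin.add_one_ne_self hr j (hv.inj h).symm)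
  have h7 := posArc_swap (x := v i) (y := v j) (fun h => hij (hv.inj h))
  refine hv.unsep (i + 1) (j + 1) _ _ h ⟨h5, h3, ?_⟩
  by_contra h8
  have h9 : posArc (v i) (v (j + 1)) < posArc (v i) (v j) :=
    lt_of_le_of_ne (not_lt.1 h8)
      (fun h => Fin.add_one_ne_self hr j (hv.inj (eq_of_posArc_eq h)))
  have := posArc_of_lt h9
  have := posArc_nonneg (v i) (v (j + 1))
  linarith

theorem eq_or_eq_of_unsep {x a b p q : S1} (hpq : s(p, q) ∈ L) (h1 : 0 < posArc p a)
    (h2 : posArc p a < posArc p q) (h3 : posArc p q < posArc p b) (ha : Unsep L a x)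
    (hb : Unsep L x b) : x = p ∨ x = q := by
  by_contra! h
  have hx : 0 < posArc p x := posArc_pos.2 h.1.symm
  rcases lt_trichotomy (posArc p x) (posArc p q) with h4 | h4 | h4
  · exact hb _ _ hpq ⟨hx, h4, h3⟩
  · exact h.2 (eq_of_posArc_eq h4)
  · exact ha _ _ hpq ⟨h1, h2, h4⟩

theorem IsPolygon.range_subset (hr : 2 ≤ r) {v w : Fin (r + 1) → S1} (hv : IsPolygon L v)
    (hw : IsWeakPolygon L w) {i j : Fin (r + 1)} (h1 : w i = v j) (h2 : w (i + 1) = v (j + 1))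
    (l : Fin (r + 1)) : ∃ k, w l = v k := by
  refine hv.exists_eq_of_unsep hr fun k => ?_
  intro p q hpq ⟨h3, h4, h5⟩
  have e1 := eq_or_eq_of_unsep hpq h3 h4 h5 (x := v j) (by rw [← h1]; exact hw.unsep _ _)
    (hv.unsep _ _)
  have e2 := eq_or_eq_of_unsep hpq h3 h4 h5 (x := v (j + 1)) (by rw [← h2]; exact hw.unsep _ _)
    (hv.unsep _ _)
  have hne : v j ≠ v (j + 1) := fun h => Fin.add_one_ne_self hr j (hv.inj h).symm
  rcases e1 with rfl | rfl
  · rcases e2 with e | rfl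
    · exact hne e.symm
    rcases hw.edge i with h | h
    · exact hne (by rw [← h1, ← h2, h])
    · have := h.2 l
      rw [h1, h2] at this
      exact this ⟨h3, h4⟩
  · rcases e2 with rfl | e
    · rcases hv.edge j with h | h
      · exact hne h
      · have := h.2 k
        rw [posArc_of_le h5.le, posArc_of_lt (u := v (j + 1)) (y := v (j + 1))
          (by rw [posArc_self]; exact h3.trans h4), posArc_self] at this
        exact this ⟨by linarith, by linarith [posArc_lt_one (v (j + 1)) (v k)]⟩
    · exact hne e.symm

theorem IsPolygon.eq_of_last_edge (hr : 2 ≤ r) {v w : Fin (r + 1) → S1} (hv : IsPolygon L v)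
    (hw : IsWeakPolygon L w) (h0 : w 0 = v 0) (hl : w (Fin.last r) = v (Fin.last r))
    {q : Fin (r + 1)} (hq0 : w q ≠ v 0) (hql : w q ≠ v (Fin.last r)) : w = v := by
  have hsub := hv.range_subset hr hw hl (by rw [Fin.last_add_one]; exact h0)
  choose f hf using hsub
  have hstep : ∀ l : Fin (r + 1), l ≠ Fin.last r → (f (l + 1)).val ≤ (f l).val + 1 := by
    intro l hlr
    rcases hw.edge l with h | h
    · rw [hf, hf] at h
      rw [hv.inj h]; omega
    · rw [hf l, hf (l + 1)] at h
      by_cases he : f l = f (l + 1)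
      · rw [he]; omega
      rcases hv.adjacent_of_mem hr h.1 he with h1 | h1
      · rw [h1, Fin.val_add_one]
        split_ifs <;> omega
      · have h2 := congrArg Fin.val h1
        rw [Fin.val_add_one] at h2
        split_ifs at h2 with h3
        · exfalso
          rw [h3] at h1 h
          rw [Fin.last_add_one] at h1
          rw [h1] at h
          refine h.2 q ⟨posArc_pos.2 hq0.symm, ?_⟩
          obtain ⟨k, hk⟩ : ∃ k, w q = v k := ⟨_, hf q⟩
          rw [hk] at hq0 hql ⊢
          have h5 := hv.hole_lt (i := Fin.last r) (j := k) (fun h => hql (by rw [h]))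
            (fun h => hq0 (by rw [h, Fin.last_add_one]))
          rw [Fin.last_add_one] at h5
          by_contra h6
          have h6 := posArc_of_le (not_lt.1 h6)
          have h7 := posArc_swap (x := v 0) (y := v (Fin.last r)) (by
            intro h
            have := congrArg Fin.val (hv.inj h)
            simp at this; omega)
          linarith [posArc_lt_one (v 0) (v k)]
        · omega
  have hmono : ∀ l m : ℕ, ∀ (hm : l + m < r + 1),
      (f ⟨l + m, hm⟩).val ≤ (f ⟨l, by omega⟩).val + m := by
    intro l m
    induction m with
    | zero => intro _; simp
    | succ m ih =>
      intro hm
      have h1 := ih (by omega)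
      have h2 := hstep ⟨l + m, by omega⟩ (by
        intro h; have := congrArg Fin.val h; simp at this; omega)
      have h3 : (⟨l + m, by omega⟩ : Fin (r + 1)) + 1 = ⟨l + (m + 1), hm⟩ := by
        apply Fin.ext
        rw [Fin.val_add_one_of_lt]
        · simp; omega
        · rw [Fin.lt_def]; simp; omega
      rw [h3] at h2
      omega
  have f0 : f 0 = 0 := hv.inj (by rw [← hf, h0])
  have fl : f (Fin.last r) = Fin.last r := hv.inj (by rw [← hf, hl])
  funext l
  rw [hf]
  congr 1
  apply Fin.ext
  have h1 := hmono 0 l (by omega)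
  have h2 := hmono l (r - l) (by omega)
  have e1 : (⟨0 + l, by omega⟩ : Fin (r + 1)) = l := Fin.ext (by simp)
  have e2 : (⟨l + (r - l), by omega⟩ : Fin (r + 1)) = Fin.last r := Fin.ext (by simp; omega)
  have e3 : (⟨0, by omega⟩ : Fin (r + 1)) = 0 := rfl
  have e4 : (⟨l, by omega⟩ : Fin (r + 1)) = l := rfl
  rw [e1, e3, f0] at h1
  rw [e2, e4, fl] at h2
  simp at h1 h2
  omega

end

theorem chordLen_eq_min (x y : S1) : chordLen s(x, y) = min (posArc x y) (1 - posArc x y) := by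
  obtain ⟨a, rfl⟩ := exists_coe_eq x
  obtain ⟨b, rfl⟩ := exists_coe_eq y
  change ‖(a : S1) - (b : S1)‖ = _
  rw [norm_sub_rev, ← AddCircle.coe_sub, posArc_coe, ← abs_sub_round_eq_min]
  exact UnitAddCircle.norm_eq

theorem abs_sub_le_of_le_chordLen {x y : S1} {t : ℝ} (ht : t < 1/6)
    (h : t ≤ |1/3 - chordLen s(x, y)|) :
    t ≤ |posArc x y - 1/3| ∧ t ≤ |posArc x y - 2/3| := by
  rw [chordLen_eq_min] at h
  rcases le_total (posArc x y) (1 - posArc x y) with h1 | h1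
  · rw [min_eq_left h1, abs_sub_comm] at h
    refine ⟨h, ?_⟩
    rw [abs_of_nonpos (by linarith)]; linarith
  · rw [min_eq_right h1] at h
    constructor
    · rw [abs_of_nonneg (by linarith)]; linarith
    · convert h using 2; ring

/-- The distance bound for tripling: points outside the `t`-neighbourhoods of `1/3`, `2/3` and
the `3 * t`-neighbourhood of `0` are mapped outside the `3 * t`-neighbourhood of `0`. -/
theorem posArc_s3_mem_Icc {x y : S1} {t : ℝ} (ht : 0 < t) (h1 : t ≤ |posArc x y - 1/3|)
    (h2 : t ≤ |posArc x y - 2/3|) (h3 : posArc x y ∈ Icc (3 * t) (1 - 3 * t)) :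
    posArc (s3 x) (s3 y) ∈ Icc (3 * t) (1 - 3 * t) := by
  obtain ⟨h4, h5⟩ := h3
  rw [posArc_s3]
  rw [le_abs] at h1 h2
  have key : ∀ k : ℤ, k + 3 * t ≤ 3 * posArc x y → 3 * posArc x y ≤ k + (1 - 3 * t) →
      Int.fract (3 * posArc x y) ∈ Icc (3 * t) (1 - 3 * t) := by
    intro k hk1 hk2
    have : Int.fract (3 * posArc x y) = 3 * posArc x y - k := by
      rw [Int.fract_eq_iff]
      exact ⟨by linarith, by linarith, k, by ring⟩
    rw [this]
    constructor <;> linarith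
  rcases h1 with h1 | h1
  · rcases h2 with h2 | h2
    · exact key 2 (by push_cast; linarith) (by push_cast; linarith)
    · exact key 1 (by push_cast; linarith) (by push_cast; linarith)
  · exact key 0 (by push_cast; linarith) (by push_cast; linarith)

/-- A short comajor gives a lamination all of whose leaves stay away from length `1/3`. -/
theorem exists_lamination_of_comajor {a t : ℝ} (ht0 : 0 < t) (ht : t < 1/6)
    (hc : s((a : S1), ((a + t : ℝ) : S1)) ∈ CsCL) :
    ∃ L, IsCubicSymLam L ∧ s((a : S1), ((a + t : ℝ) : S1)) ∈ L ∧
      ∀ x y : S1, s(x, y) ∈ L → t ≤ |posArc x y - 1/3| ∧ t ≤ |posArc x y - 2/3| := by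
  obtain ⟨L, hL, -, hcL, ⟨M, hM, hcM⟩, hdis⟩ := hc
  have hd : posArc (a : S1) ((a + t : ℝ) : S1) = t := by
    rw [posArc_coe, add_sub_cancel_left, Int.fract_eq_self]
    constructor <;> linarith
  have hmem := hcL (by
    rw [Sym2.mk_isDiag_iff]
    exact posArc_pos.1 (by linarith))
  refine ⟨L, hL, hmem, fun x y hxy => ?_⟩
  have hlen : chordLen s((a : S1), ((a + t : ℝ) : S1)) = t := by
    rw [chordLen_eq_min, hd, min_eq_left (by linarith)]
  suffices hMt : |1/3 - chordLen M| = t by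
    exact abs_sub_le_of_le_chordLen ht (hMt ▸ hM.2 _ hxy)
  obtain ⟨p, q, rfl, hp, hq⟩ := exists_rep_of_cmap_eq (hcM.symm.trans (Sym2.map_mk ..))
  have h3 : Int.fract (3 * posArc p q) = 3 * t := by
    rw [← posArc_s3, ← hp, ← hq, posArc_s3, hd, Int.fract_eq_self]
    constructor <;> linarith
  rw [Int.fract_eq_iff] at h3
  obtain ⟨-, -, k, hk⟩ := h3
  have hp0 := posArc_nonneg p q
  have hp1 := posArc_lt_one p q
  have hk0 : (-1 : ℝ) < k := by linarith
  have hk3 : (k : ℝ) < 3 := by linarith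
  have hk0' : -1 < k := by exact_mod_cast hk0
  have hk3' : k < 3 := by exact_mod_cast hk3
  interval_cases k
  · exfalso
    push_cast at hk
    have hMl : chordLen s(p, q) = t := by
      rw [chordLen_eq_min, min_eq_left (by linarith)]; linarith
    have hmaj : IsMajor L s((a : S1), ((a + t : ℝ) : S1)) :=
      ⟨hmem, fun ℓ hℓ => by rw [hlen, ← hMl]; exact hM.2 ℓ hℓ⟩
    exact (ne_of_disjoint_chordSet (hdis _ hmaj)).1 rfl
  · push_cast at hk
    rw [chordLen_eq_min, min_eq_left (by linarith), abs_of_nonpos (by linarith)]; linarith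
  · push_cast at hk
    rw [chordLen_eq_min, min_eq_right (by linarith), abs_of_nonneg (by linarith)]; linarith

theorem comajor_orbit_bound {a t : ℝ} (ht0 : 0 < t) (ht : t < 1/6)
    (hc : s((a : S1), ((a + t : ℝ) : S1)) ∈ CsCL) (n : ℕ) :
    posArc (s3^[n] (s3 (a : S1))) (s3^[n] (s3 ((a + t : ℝ) : S1))) ∈
      Icc (3 * t) (1 - 3 * t) := by
  obtain ⟨L, hL, hmem, hlen⟩ := exists_lamination_of_comajor ht0 ht hc
  have fwd : ∀ x y : S1, s(x, y) ∈ L → posArc (s3 x) (s3 y) ∈ Icc (3 * t) (1 - 3 * t) →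
      s(s3 x, s3 y) ∈ L := by
    intro x y hxy h
    rcases hL.forward _ hxy with h1 | h1
    · exact h1
    · unfold cmap at h1
      rw [Sym2.map_mk, Sym2.mk_isDiag_iff] at h1
      rw [h1, posArc_self] at h
      linarith [h.1]
  suffices s(s3^[n] (s3 (a : S1)), s3^[n] (s3 ((a + t : ℝ) : S1))) ∈ L ∧
      posArc (s3^[n] (s3 (a : S1))) (s3^[n] (s3 ((a + t : ℝ) : S1))) ∈ Icc (3 * t) (1 - 3 * t) from
    this.2
  induction n with
  | zero =>
    have hd : posArc (s3 (a : S1)) (s3 ((a + t : ℝ) : S1)) = 3 * t := by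
      rw [s3_coe, s3_coe, posArc_coe, Int.fract_eq_iff]
      exact ⟨by linarith, by linarith, 0, by push_cast; ring⟩
    have h2 : posArc (s3 (a : S1)) (s3 ((a + t : ℝ) : S1)) ∈ Icc (3 * t) (1 - 3 * t) := by
      rw [hd]; constructor <;> linarith
    exact ⟨fwd _ _ hmem h2, h2⟩
  | succ n ih =>
    simp only [Function.iterate_succ_apply']
    have h := hlen _ _ ih.1
    have h2 := posArc_s3_mem_Icc ht0 h.1 h.2 ih.2
    exact ⟨fwd _ _ ih.1 h2, h2⟩

section

variable {L : Set Chord} {r : ℕ}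

/-- The point `z` lies in the open arc cut off by the edge of index `a` of the polygon `A`. -/
def InCap (A : Fin (r + 1) → S1) (a : Fin (r + 1)) (z : S1) : Prop :=
  0 < posArc (A a) z ∧ posArc (A a) z < posArc (A a) (A (a + 1))

theorem InCap.posArc_lt {A : Fin (r + 1) → S1} {a : Fin (r + 1)} {z : S1} (h : InCap A a z) :
    0 < posArc z (A (a + 1)) ∧ posArc z (A (a + 1)) < posArc z (A a) ∧
      posArc (A a) (A (a + 1)) = posArc z (A (a + 1)) - posArc z (A a) + 1 := by
  have h1 := posArc_of_le h.2.le
  have h2 := posArc_of_lt (u := A a) (x := z) (y := A a) (by rw [posArc_self]; exact h.1)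
  rw [posArc_self] at h2
  have := posArc_lt_one (A a) (A (a + 1))
  refine ⟨?_, ?_, ?_⟩ <;> linarith [h.2, h.1]

theorem IsPolygon.mem_Icc_of_inCap {A : Fin (r + 1) → S1} (hA : IsPolygon L A)
    {a : Fin (r + 1)} {z : S1} (h : InCap A a z) (k : Fin (r + 1)) :
    posArc z (A k) ∈ Icc (posArc z (A (a + 1))) (posArc z (A a)) := by
  obtain ⟨h1, h2, h3⟩ := h.posArc_lt
  by_cases hk : k = a
  · subst hk; exact ⟨h2.le, le_rfl⟩
  have h4 := hA.hole hk
  have h5 := posArc_lt_one z (A k)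
  have h6 := posArc_nonneg z (A k)
  rcases le_or_gt (posArc z (A a)) (posArc z (A k)) with h7 | h7
  · exfalso
    rw [posArc_of_le h7] at h4
    linarith
  · rw [posArc_of_lt h7] at h4
    constructor <;> linarith

theorem IsPolygon.mem_Ioo_of_inCap {A : Fin (r + 1) → S1} (hA : IsPolygon L A)
    {a : Fin (r + 1)} {z : S1} (h : InCap A a z) {k : Fin (r + 1)} (h1 : k ≠ a)
    (h2 : k ≠ a + 1) : posArc z (A k) ∈ Ioo (posArc z (A (a + 1))) (posArc z (A a)) := by
  obtain ⟨h3, h4⟩ := hA.mem_Icc_of_inCap h k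
  exact ⟨lt_of_le_of_ne h3 fun e => h2 (hA.inj (eq_of_posArc_eq e)).symm,
    lt_of_le_of_ne h4 fun e => h1 (hA.inj (eq_of_posArc_eq e))⟩

/-- A polygon lies on one side of the leaf carrying an edge of another polygon. -/
theorem IsPolygon.one_side (hr : 2 ≤ r) {A B : Fin (r + 1) → S1} (hA : IsPolygon L A)
    (hB : IsPolygon L B) {a : Fin (r + 1)} {z : S1} (h : InCap A a z) :
    (∀ k, posArc z (B k) ∈ Icc (posArc z (A (a + 1))) (posArc z (A a))) ∨
    (∀ k, posArc z (B k) ≤ posArc z (A (a + 1)) ∨ posArc z (A a) ≤ posArc z (B k)) := by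
  obtain ⟨h1, h2, h3⟩ := h.posArc_lt
  by_contra! hcon
  obtain ⟨⟨k, hk⟩, ⟨l, hl1, hl2⟩⟩ := hcon
  have hl : posArc (A a) (B l) = posArc z (B l) - posArc z (A a) + 1 := posArc_of_lt hl2
  refine hB.unsep k l _ _ (hA.mem hr a) ?_
  rw [hl, h3]
  rcases lt_or_ge (posArc z (B k)) (posArc z (A (a + 1))) with h4 | h4
  · rw [posArc_of_lt (h4.trans h2)]
    refine ⟨?_, ?_, ?_⟩ <;> linarith [posArc_nonneg z (B k), posArc_lt_one z (A a)]
  · have h5 : posArc z (A a) < posArc z (B k) := by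
      by_contra h5
      exact hk ⟨h4, not_lt.1 h5⟩
    rw [posArc_of_le h5.le]
    refine ⟨?_, ?_, ?_⟩ <;> linarith [posArc_lt_one z (B k)]

/-- If two polygons have edges whose caps contain a common point, the polygon with the smaller
cap lies in the closure of the larger cap. -/
theorem IsPolygon.subset_cap (hr : 2 ≤ r) {A B : Fin (r + 1) → S1} (hA : IsPolygon L A)
    (hB : IsPolygon L B) {a b : Fin (r + 1)} {z : S1} (ha : InCap A a z) (hb : InCap B b z)
    (hsum : posArc (A a) (A (a + 1)) + posArc (B b) (B (b + 1)) < 1)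
    (hle : posArc (B b) (B (b + 1)) ≤ posArc (A a) (A (a + 1)))
    (hne : ¬ (A a = B b ∧ A (a + 1) = B (b + 1))) (k : Fin (r + 1)) :
    posArc z (B k) ≤ posArc z (A (a + 1)) ∨ posArc z (A a) ≤ posArc z (B k) := by
  obtain ⟨a1, a2, a3⟩ := ha.posArc_lt
  obtain ⟨b1, b2, b3⟩ := hb.posArc_lt
  rcases hA.one_side hr hB ha with h | h
  · exfalso
    have hB1 := h (b + 1)
    have hB0 := h b
    rcases hB.one_side hr hA hb with h' | h'
    · have hA1 := h' (a + 1)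
      have hA0 := h' a
      exact hne ⟨eq_of_posArc_eq (u := z) (le_antisymm hA0.2 hB0.2),
        eq_of_posArc_eq (u := z) (le_antisymm hB1.1 hA1.1)⟩
    · have hA1 := h' (a + 1)
      have hA0 := h' a
      have hA2 := h' (a + 1 + 1)
      have hA3 := hA.mem_Ioo_of_inCap ha (Fin.add_one_add_one_ne_self hr a)
        (Fin.add_one_ne_self hr (a + 1))
      have := posArc_lt_one z (A a)
      have := posArc_lt_one z (B b)
      rw [a3, b3] at hsum hle
      obtain ⟨hA3, hA4⟩ := hA3
      rcases hA1 with hA1 | hA1 <;> rcases hA0 with hA0 | hA0 <;> try linarith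
      rcases hA2 with hA2 | hA2 <;> linarith
  · exact h k

theorem IsPolygon.lt_of_ne_of_inCap (hr : 2 ≤ r) {B : Fin (r + 1) → S1} (hB : IsPolygon L B)
    {a b : Fin (r + 1)} {z : S1} (hb : InCap B b z) (hab : a ≠ b) :
    posArc z (B a) < posArc z (B (a + 1)) := by
  by_contra h
  have h1 : posArc z (B (a + 1)) < posArc z (B a) :=
    lt_of_le_of_ne (not_lt.1 h)
      (fun e => Fin.add_one_ne_self hr a (hB.inj (eq_of_posArc_eq e)))
  have h2 := hB.hole (i := a) hab.symm
  rw [posArc_of_lt h1, posArc_of_le (hB.mem_Icc_of_inCap hb a).2] at h2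
  linarith [posArc_lt_one z (B b), posArc_nonneg z (B (a + 1))]

theorem IsPolygon.straddle (hr : 2 ≤ r) {A B : Fin (r + 1) → S1}
    (hB : IsPolygon L B) {a b : Fin (r + 1)} {z : S1} (ha : InCap A a z) (hb : InCap B b z)
    (hab : a ≠ b) (hle : posArc (A a) (A (a + 1)) ≤ posArc (B a) (B (a + 1)))
    (hcap : ∀ k, posArc z (B k) ≤ posArc z (A (a + 1)) ∨ posArc z (A a) ≤ posArc z (B k)) :
    posArc z (B a) ≤ posArc z (A (a + 1)) ∧ posArc z (A a) ≤ posArc z (B (a + 1)) := by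
  obtain ⟨a1, a2, a3⟩ := ha.posArc_lt
  have h1 := hB.lt_of_ne_of_inCap hr hb hab
  rw [posArc_of_le h1.le, a3] at hle
  have := posArc_nonneg z (B a)
  have := posArc_lt_one z (B (a + 1))
  have := posArc_lt_one z (A a)
  rcases hcap a with h2 | h2 <;> rcases hcap (a + 1) with h3 | h3 <;>
    first | exact ⟨h2, h3⟩ | (exfalso; linarith)

/-- Three polygons with caps of distinct indices around a common point cannot exist when every
edge of the innermost one is at least as long as the corresponding cap. -/
theorem no_three_caps (hr : 2 ≤ r) {A B C : Fin (r + 1) → S1} (hA : IsPolygon L A)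
    (hB : IsPolygon L B) (hC : IsPolygon L C) {a b c : Fin (r + 1)} {z : S1}
    (ha : InCap A a z) (hb : InCap B b z) (hc : InCap C c z)
    (hab : a ≠ b) (hcb : c ≠ b) (hac : a ≠ c)
    (sab : posArc (A a) (A (a + 1)) + posArc (B b) (B (b + 1)) < 1)
    (scb : posArc (C c) (C (c + 1)) + posArc (B b) (B (b + 1)) < 1)
    (sac : posArc (A a) (A (a + 1)) + posArc (C c) (C (c + 1)) < 1)
    (lab : posArc (B b) (B (b + 1)) ≤ posArc (A a) (A (a + 1)))
    (lcb : posArc (B b) (B (b + 1)) ≤ posArc (C c) (C (c + 1)))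
    (nab : ¬ (A a = B b ∧ A (a + 1) = B (b + 1)))
    (ncb : ¬ (C c = B b ∧ C (c + 1) = B (b + 1)))
    (la : posArc (A a) (A (a + 1)) ≤ posArc (B a) (B (a + 1)))
    (lc : posArc (C c) (C (c + 1)) ≤ posArc (B c) (B (c + 1))) : False := by
  obtain ⟨p1, p2⟩ := hB.straddle hr ha hb hab la (hA.subset_cap hr hB ha hb sab lab nab)
  obtain ⟨q1, q2⟩ := hB.straddle hr hc hb hcb lc (hC.subset_cap hr hB hc hb scb lcb ncb)
  obtain ⟨a1, a2, a3⟩ := ha.posArc_lt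
  obtain ⟨c1, c2, c3⟩ := hc.posArc_lt
  have h1 := hB.lt_of_ne_of_inCap hr hb hab
  have h2 := hB.lt_of_ne_of_inCap hr hb hcb
  have h3 := hB.hole (i := a) hac.symm
  have h4 := hB.hole (i := c) hac
  rw [a3, c3] at sac
  rw [posArc_of_le h1.le] at h3
  rw [posArc_of_le h2.le] at h4
  have := posArc_lt_one z (A a)
  have := posArc_lt_one z (C c)
  rcases le_total (posArc z (B a)) (posArc z (B c)) with h | h
  · rw [posArc_of_le h] at h3
    linarith
  · rw [posArc_of_le h] at h4
    linarith

end

/-- The point `e` is the midpoint of the arc of length `τ` between a pair of leaves of lengths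
`1/3 + τ` and `1/3 - τ` with disjoint endpoints and the same `s3`-image. -/
def IsStripMid (L : Set Chord) (τ : ℝ) (e : S1) : Prop :=
  s(e + ((-(τ/2) : ℝ) : S1), e + ((1/3 + τ/2 : ℝ) : S1)) ∈ L ∧
  s(e + ((τ/2 : ℝ) : S1), e + ((1/3 - τ/2 : ℝ) : S1)) ∈ L

theorem IsCubicSymLam.stripMid_antip {L : Set Chord} (hL : IsCubicSymLam L) {τ : ℝ} {e : S1}
    (h : IsStripMid L τ e) : IsStripMid L τ (antip e) := by
  have key : ∀ x y : S1, antip x + y = antip (x + y) := fun x y => add_right_comm _ _ _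
  unfold IsStripMid
  simp only [key]
  exact ⟨hL.mem_antip h.1, hL.mem_antip h.2⟩

theorem fract_three_mul {ω : ℝ} (h0 : 0 ≤ ω) (h1 : ω < 1) :
    (ω < 1/3 ∧ Int.fract (3 * ω) = 3 * ω) ∨
    (1/3 ≤ ω ∧ ω < 2/3 ∧ Int.fract (3 * ω) = 3 * ω - 1) ∨
    (2/3 ≤ ω ∧ Int.fract (3 * ω) = 3 * ω - 2) := by
  rcases lt_or_ge ω (1/3) with h | h
  · left
    exact ⟨h, Int.fract_eq_self.2 ⟨by linarith, by linarith⟩⟩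
  · right
    rcases lt_or_ge ω (2/3) with h' | h'
    · left
      refine ⟨h, h', Int.fract_eq_iff.2 ⟨by linarith, by linarith, 1, by push_cast; ring⟩⟩
    · right
      exact ⟨h', Int.fract_eq_iff.2 ⟨by linarith, by linarith, 2, by push_cast; ring⟩⟩

/-- A leaf cutting off an arc of length `h` from `P` does not cross another leaf. -/
theorem IsLamination.not_mem_offset {L : Set Chord} (hL : IsLamination L) {P h x y : ℝ}
    (hP : s((P : S1), ((P + h : ℝ) : S1)) ∈ L) (hx0 : 0 < x) (hx : x < h) (hy : h < y)
    (hy1 : y < 1) : s(((P + x : ℝ) : S1), ((P + y : ℝ) : S1)) ∉ L ∧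
    s(((P + x : ℝ) : S1), ((P + (y - 1) : ℝ) : S1)) ∉ L ∧
    s(((P + y : ℝ) : S1), ((P + (x + 1) : ℝ) : S1)) ∉ L := by
  have h1 : s(((P + x : ℝ) : S1), ((P + y : ℝ) : S1)) ∉ L := fun h1 =>
    hL.not_mem_of_lt (by linarith) (by linarith) (by linarith) (by linarith) hP h1
  have e1 : ((P + (y - 1) : ℝ) : S1) = ((P + y : ℝ) : S1) := by
    rw [← coe_add_one]; congr 1; ring
  have e2 : ((P + (x + 1) : ℝ) : S1) = ((P + x : ℝ) : S1) := by
    rw [← coe_add_one (P + x)]; congr 1; ring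
  rw [e1, e2]
  exact ⟨h1, h1, by rwa [Sym2.eq_swap]⟩

section

variable {L : Set Chord} {P h ω τ : ℝ}

theorem IsStripMid.coe (hM : IsStripMid L τ ((P + ω : ℝ) : S1)) :
    s(((P + (ω - τ/2) : ℝ) : S1), ((P + (ω + 1/3 + τ/2) : ℝ) : S1)) ∈ L ∧
    s(((P + (ω + τ/2) : ℝ) : S1), ((P + (ω + 1/3 - τ/2) : ℝ) : S1)) ∈ L := by
  unfold IsStripMid at hM
  simp only [← AddCircle.coe_add] at hM
  rwa [show P + ω + -(τ/2) = P + (ω - τ/2) by ring,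
    show P + ω + (1/3 + τ/2) = P + (ω + 1/3 + τ/2) by ring,
    show P + ω + τ/2 = P + (ω + τ/2) by ring,
    show P + ω + (1/3 - τ/2) = P + (ω + 1/3 - τ/2) by ring] at hM

theorem IsLamination.offset_mem_of_middle (hL : IsLamination L)
    (hP : s((P : S1), ((P + h : ℝ) : S1)) ∈ L) (hM : IsStripMid L τ ((P + ω : ℝ) : S1))
    (hτ0 : 0 < τ) (hω0 : 0 ≤ ω) (hω1 : ω < 1) (hh1 : 1/3 + τ ≤ h)
    (hh2 : h ≤ 2/3 - τ)
    (hout : ¬ (0 < Int.fract (3 * ω) ∧ Int.fract (3 * ω) < 3 * h - 1)) :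
    1/3 ≤ ω ∧ ω < 2/3 := by
  obtain ⟨h1, -⟩ := hM.coe
  have no : ∀ {x y}, 0 < x → x < h → h < y → y < 1 → _ := fun a b c d =>
    hL.not_mem_offset hP a b c d
  rcases fract_three_mul hω0 hω1 with ⟨c1, c2⟩ | ⟨c1, c2, c3⟩ | ⟨c1, c2⟩
  · exfalso
    rw [c2] at hout
    rcases hω0.eq_or_lt with rfl | hω0
    · have := (no (x := 0 + 1/3 + τ/2) (y := 1 + (0 - τ/2)) (by linarith) (by linarith)
        (by linarith) (by linarith)).2.1
      rw [add_sub_cancel_left, Sym2.eq_swap] at this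
      exact this h1
    · have : 3 * h - 1 ≤ 3 * ω := by
        by_contra h'; exact hout ⟨by linarith, by linarith⟩
      exact (no (by linarith) (by linarith) (by linarith) (by linarith)).1 h1
  · exact ⟨c1, c2⟩
  · exfalso
    rw [c2] at hout
    have := (no (y := ω - τ/2) (x := ω + 1/3 + τ/2 - 1) (by linarith) (by linarith)
        (by
          by_contra h'
          apply hout
          rcases c1.eq_or_lt with rfl | c1
          · linarith
          · constructor <;> linarith)
        (by linarith)).2.2
    rw [sub_add_cancel] at this
    exact this h1

theorem IsLamination.offset_mem_of_long (hL : IsLamination L)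
    (hP : s((P : S1), ((P + h : ℝ) : S1)) ∈ L) (hM : IsStripMid L τ ((P + ω : ℝ) : S1))
    (hτ0 : 0 < τ) (hω0 : 0 ≤ ω) (hω1 : ω < 1) (hh1 : 2/3 + τ ≤ h) (hh2 : h < 1 - τ)
    (hout : ¬ (0 < Int.fract (3 * ω) ∧ Int.fract (3 * ω) < 3 * h - 2)) :
    0 < ω ∧ ω ≤ 1/3 := by
  obtain ⟨h1, h2⟩ := hM.coe
  have no : ∀ {x y}, 0 < x → x < h → h < y → y < 1 → _ := fun a b c d =>
    hL.not_mem_offset hP a b c d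
  rcases fract_three_mul hω0 hω1 with ⟨c1, c2⟩ | ⟨c1, c2, c3⟩ | ⟨c1, c2⟩
  · rcases hω0.eq_or_lt with rfl | hω0
    · exfalso
      have := (no (x := 0 + 1/3 + τ/2) (y := 1 + (0 - τ/2)) (by linarith) (by linarith)
        (by linarith) (by linarith)).2.1
      rw [add_sub_cancel_left, Sym2.eq_swap] at this
      exact this h1
    · exact ⟨hω0, c1.le⟩
  · rcases c1.eq_or_lt with rfl | c1
    · norm_num
    exfalso
    rw [c3] at hout
    have : 3 * h - 2 ≤ 3 * ω - 1 := by
      by_contra h'; exact hout ⟨by linarith, by linarith⟩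
    rcases lt_or_ge ω (2/3 - τ/2) with h3 | h3
    · exact (no (by linarith) (by linarith) (by linarith) (by linarith)).1 h1
    · exact (no (by linarith) (by linarith) (by linarith) (by linarith)).1 h2
  · exfalso
    rw [c2] at hout
    rcases c1.eq_or_lt with rfl | c1
    · exact (no (by linarith) (by linarith) (by linarith) (by linarith)).1 h2
    have : 3 * h - 2 ≤ 3 * ω - 2 := by
      by_contra h'; exact hout ⟨by linarith, by linarith⟩
    rcases lt_or_ge h (ω - τ/2) with h3 | h3
    · have := (no (y := ω - τ/2) (x := ω + 1/3 + τ/2 - 1) (by linarith) (by linarith)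
        (by linarith) (by linarith)).2.2
      rw [sub_add_cancel] at this
      exact this h1
    · have := (no (y := ω + τ/2) (x := ω + 1/3 - τ/2 - 1) (by linarith) (by linarith)
        (by linarith) (by linarith)).2.2
      rw [sub_add_cancel] at this
      exact this h2

end

theorem posArc_antip_right (u x : S1) :
    posArc u (antip x) = posArc u x + 1/2 ∨ posArc u (antip x) = posArc u x - 1/2 := by
  have h : posArc x (antip x) = 1/2 := by
    unfold antip
    rw [posArc_add_coe, Int.fract_eq_self]
    norm_num
  rcases le_or_gt (posArc u x) (posArc u (antip x)) with h1 | h1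
  · left; linarith [posArc_of_le h1]
  · right; linarith [posArc_of_lt h1]

/-- The image of a leaf cutting off an arc longer than `1/3` cuts off an arc containing the image
of the midpoint `e` of a strip or the antipode of that image. -/
theorem IsCubicSymLam.stripMid_mem_image_arc {L : Set Chord} (hL : IsCubicSymLam L) {τ : ℝ}
    (hτ0 : 0 < τ) (hτ1 : τ < 1/6) {e p q : S1} (he : IsStripMid L τ e) (hpq : s(p, q) ∈ L)
    (hlong : 1/3 < posArc p q) (h1 : τ ≤ |posArc p q - 1/3|) (h2 : τ ≤ |posArc p q - 2/3|) :
    (0 < posArc (s3 p) (s3 e) ∧ posArc (s3 p) (s3 e) < posArc (s3 p) (s3 q)) ∨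
    (0 < posArc (s3 p) (s3 (antip e)) ∧
      posArc (s3 p) (s3 (antip e)) < posArc (s3 p) (s3 q)) := by
  by_contra! hcon
  obtain ⟨n1, n2⟩ := hcon
  have n1 := not_and.2 (fun h => not_lt.2 (n1 h))
  have n2 := not_and.2 (fun h => not_lt.2 (n2 h))
  obtain ⟨P, rfl⟩ := exists_coe_eq p
  have he' := hL.stripMid_antip he
  rw [posArc_s3, posArc_s3 _ q] at n1 n2
  have a0 := posArc_nonneg (P : S1) e
  have a1 := posArc_lt_one (P : S1) e
  have b0 := posArc_nonneg (P : S1) (antip e)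
  have b1 := posArc_lt_one (P : S1) (antip e)
  have hd := posArc_antip_right (P : S1) e
  have hh := posArc_lt_one (P : S1) q
  have ee : e = ((P + posArc P e : ℝ) : S1) := by rw [AddCircle.coe_add, add_posArc]
  have ea : antip e = ((P + posArc P (antip e) : ℝ) : S1) := by rw [AddCircle.coe_add, add_posArc]
  have eq : q = ((P + posArc P q : ℝ) : S1) := by rw [AddCircle.coe_add, add_posArc]
  rw [ee] at he
  rw [ea] at he'
  rw [eq] at hpq
  generalize posArc (P : S1) e = ω at *
  generalize posArc (P : S1) (antip e) = ω' at *
  generalize posArc (P : S1) q = h at *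
  rw [abs_of_pos (by linarith)] at h1
  rcases fract_three_mul (ω := h) (by linarith) hh with ⟨c1, c2⟩ | ⟨c1, c2, c3⟩ | ⟨c1, c2⟩
  · linarith
  · rw [c3] at n1 n2
    rw [abs_of_neg (by linarith)] at h2
    have r1 := hL.offset_mem_of_middle hpq he hτ0 a0 a1 (by linarith) (by linarith) n1
    have r2 := hL.offset_mem_of_middle hpq he' hτ0 b0 b1 (by linarith) (by linarith) n2
    rcases hd with hd | hd <;> linarith [r1.1, r1.2, r2.1, r2.2]
  · rw [c2] at n1 n2
    rw [abs_of_nonneg (by linarith)] at h2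
    rcases lt_or_ge h (1 - τ) with h3 | h3
    · have r1 := hL.offset_mem_of_long hpq he hτ0 a0 a1 (by linarith) (by linarith) n1
      have r2 := hL.offset_mem_of_long hpq he' hτ0 b0 b1 (by linarith) (by linarith) n2
      rcases hd with hd | hd <;> linarith [r1.1, r1.2, r2.1, r2.2]
    · have k1 : Int.fract (3 * ω) = 0 ∨ 1 - 3 * τ ≤ Int.fract (3 * ω) := by
        by_contra! hk
        exact n1 ⟨lt_of_le_of_ne (Int.fract_nonneg _) (Ne.symm hk.1), by linarith [hk.2]⟩
      have k2 : Int.fract (3 * ω') = 0 ∨ 1 - 3 * τ ≤ Int.fract (3 * ω') := by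
        by_contra! hk
        exact n2 ⟨lt_of_le_of_ne (Int.fract_nonneg _) (Ne.symm hk.1), by linarith [hk.2]⟩
      rcases fract_three_mul a0 a1 with ⟨u1, u2⟩ | ⟨u1, u2, u3⟩ | ⟨u1, u2⟩ <;>
      rcases fract_three_mul b0 b1 with ⟨v1, v2⟩ | ⟨v1, v2, v3⟩ | ⟨v1, v2⟩ <;>
      rcases k1 with k1 | k1 <;> rcases k2 with k2 | k2 <;> rcases hd with hd | hd <;> linarith

theorem IsInvLam.exists_stripMid_of_coe {L : Set Chord} (hL : IsInvLam L) {p τ : ℝ} (hτ0 : 0 < τ)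
    (hτ1 : τ < 1/6) (h : s((p : S1), ((p + 1/3 + τ : ℝ) : S1)) ∈ L) : ∃ e, IsStripMid L τ e := by
  have hne : s3 (p : S1) ≠ s3 ((p + 1/3 + τ : ℝ) : S1) := by
    rw [← posArc_pos, s3_coe, s3_coe, posArc_coe]
    have : Int.fract (3 * (p + 1/3 + τ) - 3 * p) = 3 * τ := by
      rw [Int.fract_eq_iff]
      exact ⟨by linarith, by linarith, 1, by push_cast; ring⟩
    linarith
  have hs := hL.sibling_leaves h hne
  simp only [coe_add_third_add_third] at hs
  simp only [coe_add_third] at hs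
  rcases hs with ⟨h1, -⟩ | ⟨h1, -⟩
  · exact (hL.not_mem_of_lt (by linarith) (by linarith) (by linarith) (by linarith) h h1).elim
  · refine ⟨((p + τ/2 : ℝ) : S1), ?_, ?_⟩
    · rw [← AddCircle.coe_add, ← AddCircle.coe_add, show p + τ/2 + -(τ/2) = p by ring,
        show p + τ/2 + (1/3 + τ/2) = p + 1/3 + τ by ring]
      exact h
    · rw [← AddCircle.coe_add, ← AddCircle.coe_add, show p + τ/2 + τ/2 = p + τ by ring,
        show p + τ/2 + (1/3 - τ/2) = p + 1/3 by ring, Sym2.eq_swap, ← coe_add_one (p + τ),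
        show p + τ + 1 = p + 1/3 + τ + 2/3 by ring]
      exact h1

theorem IsCubicSymLam.exists_stripMid {L : Set Chord} (hL : IsCubicSymLam L) {x y : S1} {τ : ℝ}
    (hτ0 : 0 < τ) (hτ1 : τ < 1/6) (hxy : s(x, y) ∈ L)
    (h : |posArc x y - 1/3| = τ ∨ |posArc x y - 2/3| = τ) : ∃ e, IsStripMid L τ e := by
  have short : ∀ p : ℝ, s((p : S1), ((p + 1/3 - τ : ℝ) : S1)) ∈ L → ∃ e, IsStripMid L τ e := by
    intro p hp
    have hne : s3 (p : S1) ≠ s3 ((p + 1/3 - τ : ℝ) : S1) := by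
      rw [← posArc_pos, s3_coe, s3_coe, posArc_coe]
      have : Int.fract (3 * (p + 1/3 - τ) - 3 * p) = 1 - 3 * τ := by
        rw [Int.fract_eq_iff]
        exact ⟨by linarith, by linarith, 0, by push_cast; ring⟩
      linarith
    have hs := hL.sibling_leaves hp hne
    simp only [coe_add_third_add_third] at hs
    simp only [coe_add_third] at hs
    rcases hs with ⟨h1, -⟩ | ⟨h1, -⟩
    · have h2 := hL.mem_antip hp
      unfold antip at h2
      rw [← AddCircle.coe_add, ← AddCircle.coe_add] at h2
      exact (hL.not_mem_of_lt (by linarith) (by linarith) (by linarith) (by linarith) h1 h2).elim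
    · refine hL.exists_stripMid_of_coe (p := p - τ) hτ0 hτ1 ?_
      rw [show p - τ + 1/3 + τ = p + 1/3 by ring, Sym2.eq_swap, ← coe_add_one (p - τ),
        show p - τ + 1 = p + 1/3 - τ + 2/3 by ring]
      exact h1
  obtain ⟨p, rfl⟩ := exists_coe_eq x
  obtain ⟨d, hd⟩ : ∃ d, d = posArc (p : S1) y := ⟨_, rfl⟩
  have hy : y = ((p + d : ℝ) : S1) := by rw [hd, AddCircle.coe_add, add_posArc]
  rw [← hd] at h
  rw [hy] at hxy
  have hyx : s(((p + d : ℝ) : S1), ((p + 1 : ℝ) : S1)) ∈ L := by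
    rw [coe_add_one, Sym2.eq_swap]; exact hxy
  rw [abs_eq hτ0.le, abs_eq hτ0.le] at h
  rcases h with (h | h) | (h | h)
  · refine hL.exists_stripMid_of_coe (p := p) hτ0 hτ1 ?_
    rwa [show p + 1/3 + τ = p + d by linarith]
  · refine short p ?_
    rwa [show p + 1/3 - τ = p + d by linarith]
  · refine short (p + d) ?_
    rwa [show p + d + 1/3 - τ = p + 1 by linarith]
  · refine hL.exists_stripMid_of_coe (p := p + d) hτ0 hτ1 ?_
    rwa [show p + d + 1/3 + τ = p + 1 by linarith]

theorem antip_iterate_antip_iterate (ε : ℕ) (x : S1) : antip^[ε] (antip^[ε] x) = x := by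
  induction ε with
  | zero => rfl
  | succ n ih =>
    rw [Function.iterate_succ_apply, Function.iterate_succ_apply' antip n x, antip_antip, ih]

theorem posArc_antip_iterate (ε : ℕ) (x y : S1) :
    posArc (antip^[ε] x) (antip^[ε] y) = posArc x y := by
  induction ε with
  | zero => rfl
  | succ n ih => rw [Function.iterate_succ_apply', Function.iterate_succ_apply', posArc_antip, ih]

theorem s3_iterate_antip_iterate (n ε : ℕ) (x : S1) :
    s3^[n] (antip^[ε] x) = antip^[ε] (s3^[n] x) :=
  (Function.Commute.iterate_iterate (f := s3) (g := antip) s3_antip n ε) x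

/-- A polygon of periodic points with a distinguished longest edge of length `3 * t`, whose iterated
images stay at least that long. -/
structure IsPeriodicPolygon (L : Set Chord) {r : ℕ} (v : Fin (r + 1) → S1) (t : ℝ) (N : ℕ) :
    Prop extends IsPolygon L v where
  two_le : 2 ≤ r
  t_pos : 0 < t
  t_lt : t < 1/6
  length : posArc (v 0) (v (Fin.last r)) = 3 * t
  bound : ∀ n, posArc (s3^[n] (v 0)) (s3^[n] (v (Fin.last r))) ∈ Icc (3 * t) (1 - 3 * t)
  N_pos : 1 ≤ N
  periodic : ∀ i, s3^[N] (v i) = v i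

section

variable {L : Set Chord} {r : ℕ} {v : Fin (r + 1) → S1} {t : ℝ} {N : ℕ}

theorem IsPeriodicPolygon.iterate_mul (h : IsPeriodicPolygon L v t N) (m : ℕ)
    (i : Fin (r + 1)) : s3^[m * N] (v i) = v i := by
  rw [mul_comm, Function.iterate_mul]
  exact Function.iterate_fixed (h.periodic i) m

theorem IsPeriodicPolygon.iterate_inj (h : IsPeriodicPolygon L v t N) (n : ℕ) :
    Function.Injective (fun i => s3^[n] (v i)) := by
  intro i j hij
  have h1 : s3^[n * N - n] (s3^[n] (v i)) = s3^[n * N - n] (s3^[n] (v j)) := congrArg _ hij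
  rw [← Function.iterate_add_apply, ← Function.iterate_add_apply,
    Nat.sub_add_cancel (Nat.le_mul_of_pos_right n h.N_pos), h.iterate_mul, h.iterate_mul] at h1
  exact h.inj h1

theorem IsPeriodicPolygon.ne_last (h : IsPeriodicPolygon L v t N) :
    (0 : Fin (r + 1)) ≠ Fin.last r := by
  intro e
  have := congrArg Fin.val e
  have := h.two_le
  simp at *
  omega

theorem IsPeriodicPolygon.posArc_zero (h : IsPeriodicPolygon L v t N) (k : Fin (r + 1)) :
    posArc (v 0) (v k) ≤ 3 * t ∧ (posArc (v 0) (v k) = 3 * t → k = Fin.last r) := by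
  refine ⟨?_, fun e => h.inj (eq_of_posArc_eq (e.trans h.length.symm))⟩
  by_contra! hlt
  have h1 := posArc_swap (x := v 0) (y := v (Fin.last r)) (fun e => h.ne_last (h.inj e))
  have h2 : posArc (v (Fin.last r)) (v k) = _ := posArc_of_le (h.length.le.trans hlt.le)
  have h3 := h.hole (i := Fin.last r) (j := k) (by rintro rfl; exact hlt.ne h.length.symm)
  rw [Fin.last_add_one] at h3
  linarith [posArc_lt_one (v 0) (v k)]

theorem IsPeriodicPolygon.posArc_zero_eq (h : IsPeriodicPolygon L v t N) {k : Fin (r + 1)}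
    (hk : posArc (v 0) (v k) = 0) : k = 0 :=
  (h.inj (posArc_eq_zero.1 hk)).symm

theorem IsPeriodicPolygon.eq_ends (h : IsPeriodicPolygon L v t N) {k l : Fin (r + 1)}
    (hkl : posArc (v k) (v l) ∈ Icc (3 * t) (1 - 3 * t)) :
    (k = 0 ∧ l = Fin.last r) ∨ (k = Fin.last r ∧ l = 0) := by
  obtain ⟨h1, h2⟩ := hkl
  have k1 := h.posArc_zero k
  have l1 := h.posArc_zero l
  have k0 := posArc_nonneg (v 0) (v k)
  have l0 := posArc_nonneg (v 0) (v l)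
  rcases le_or_gt (posArc (v 0) (v k)) (posArc (v 0) (v l)) with h3 | h3
  · rw [posArc_of_le h3] at h1 h2
    exact Or.inl ⟨h.posArc_zero_eq (by linarith), l1.2 (by linarith)⟩
  · rw [posArc_of_lt h3] at h1 h2
    exact Or.inr ⟨k1.2 (by linarith), h.posArc_zero_eq (by linarith)⟩

/-- The polygons in the orbit of a periodic polygon and of its antipode. -/
def orbitPolygon (v : Fin (r + 1) → S1) (n ε : ℕ) : Fin (r + 1) → S1 :=
  fun i => antip^[ε] (s3^[n] (v i))

theorem IsPeriodicPolygon.orbit (h : IsPeriodicPolygon L v t N) (hL : IsCubicSymLam L) (n ε : ℕ) :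
    IsPolygon L (orbitPolygon v n ε) := by
  induction ε with
  | zero => exact ⟨h.iterate_s3 hL.toIsInvLam n, h.iterate_inj n⟩
  | succ ε ih =>
    have e : orbitPolygon v n (ε + 1) = fun i => antip (orbitPolygon v n ε i) := by
      funext i
      exact Function.iterate_succ_apply' _ _ _
    rw [e]
    refine ⟨ih.antip hL, fun i j hij => ih.inj ?_⟩
    have := congrArg antip hij
    simpa only [antip_antip] using this

theorem posArc_orbitPolygon (n ε : ℕ) (i j : Fin (r + 1)) :
    posArc (orbitPolygon v n ε i) (orbitPolygon v n ε j) =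
      posArc (s3^[n] (v i)) (s3^[n] (v j)) := posArc_antip_iterate _ _ _

/-- Edges of different indices have disjoint orbits (up to the antipodal map). -/
theorem IsPeriodicPolygon.index_eq (h : IsPeriodicPolygon L v t N) (hL : IsCubicSymLam L)
    {n₁ n₂ ε₁ ε₂ : ℕ} {a b : Fin (r + 1)}
    (h1 : orbitPolygon v n₁ ε₁ a = orbitPolygon v n₂ ε₂ b)
    (h2 : orbitPolygon v n₁ ε₁ (a + 1) = orbitPolygon v n₂ ε₂ (b + 1)) : a = b := by
  have key : ∀ i j, orbitPolygon v n₁ ε₁ i = orbitPolygon v n₂ ε₂ j →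
      orbitPolygon v (n₁ * N - n₁ + n₂) (ε₁ + ε₂) j = v i := by
    intro i j hij
    have h3 := congrArg (fun x => antip^[ε₁] (s3^[n₁ * N - n₁] x)) hij
    simp only [orbitPolygon] at h3
    rw [s3_iterate_antip_iterate, s3_iterate_antip_iterate, antip_iterate_antip_iterate,
      ← Function.iterate_add_apply, ← Function.iterate_add_apply, ← Function.iterate_add_apply,
      Nat.sub_add_cancel (Nat.le_mul_of_pos_right n₁ h.N_pos), h.iterate_mul] at h3
    exact h3.symm
  set w := orbitPolygon v (n₁ * N - n₁ + n₂) (ε₁ + ε₂) with hw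
  have hwp : IsPolygon L w := h.orbit hL _ _
  have hsub := h.range_subset h.two_le hwp.toIsWeakPolygon (key _ _ h1) (key _ _ h2)
  have hb : posArc (w 0) (w (Fin.last r)) ∈ Icc (3 * t) (1 - 3 * t) := by
    rw [hw, posArc_orbitPolygon]; exact h.bound _
  obtain ⟨k, hk⟩ := hsub 0
  obtain ⟨l, hl⟩ := hsub (Fin.last r)
  obtain ⟨m, hm⟩ := hsub 1
  have r2 := h.two_le
  have one0 : (1 : Fin (r + 1)) ≠ 0 := by
    have := Fin.add_one_ne_self r2 0
    rwa [zero_add] at this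
  have onel : (1 : Fin (r + 1)) ≠ Fin.last r := by
    have := Fin.add_one_add_one_ne_self r2 (Fin.last r)
    rw [Fin.last_add_one, zero_add] at this
    exact this
  have q0 : w 1 ≠ w 0 := fun e => one0 (hwp.inj e)
  have ql : w 1 ≠ w (Fin.last r) := fun e => onel (hwp.inj e)
  rw [hk, hl] at hb
  rcases h.eq_ends hb with ⟨rfl, rfl⟩ | ⟨rfl, rfl⟩
  · have hwv := h.eq_of_last_edge r2 hwp.toIsWeakPolygon hk hl (q := 1)
      (by rwa [← hk]) (by rwa [← hl])
    have := key _ _ h1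
    rw [hwv] at this
    exact (h.inj this).symm
  · exfalso
    have h3 := hwp.hole_lt (i := Fin.last r) (j := 1) onel (by rwa [Fin.last_add_one])
    rw [Fin.last_add_one, hk, hl, hm, h.length] at h3
    exact absurd (h.posArc_zero m).1 (not_le.2 h3)

theorem IsPeriodicPolygon.iterate_mod (h : IsPeriodicPolygon L v t N) (n : ℕ) (i : Fin (r + 1)) :
    s3^[n] (v i) = s3^[n % N] (v i) := by
  conv_lhs => rw [← Nat.mod_add_div n N, mul_comm N, Function.iterate_add_apply, h.iterate_mul]

/-- The arc cut off by the edge of index `i` of the `n`-th image of the polygon. -/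
def edgeArc (v : Fin (r + 1) → S1) (n : ℕ) (i : Fin (r + 1)) : ℝ :=
  posArc (s3^[n] (v i)) (s3^[n] (v (i + 1)))

theorem edgeArc_succ (v : Fin (r + 1) → S1) (n : ℕ) (i : Fin (r + 1)) :
    edgeArc v (n + 1) i = Int.fract (3 * edgeArc v n i) := by
  unfold edgeArc
  rw [Function.iterate_succ_apply', Function.iterate_succ_apply', posArc_s3]

theorem IsPeriodicPolygon.edgeArc_mod (h : IsPeriodicPolygon L v t N) (n : ℕ) (i : Fin (r + 1)) :
    edgeArc v n i = edgeArc v (n % N) i := by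
  unfold edgeArc
  rw [h.iterate_mod n, h.iterate_mod n]

theorem IsPeriodicPolygon.edgeArc_pos (h : IsPeriodicPolygon L v t N) (n : ℕ) (i : Fin (r + 1)) :
    0 < edgeArc v n i :=
  posArc_pos.2 fun e => Fin.add_one_ne_self h.two_le i (h.iterate_inj n e).symm

theorem IsPeriodicPolygon.edge_mem (h : IsPeriodicPolygon L v t N) (hL : IsCubicSymLam L) (n : ℕ)
    (i : Fin (r + 1)) : s(s3^[n] (v i), s3^[n] (v (i + 1))) ∈ L :=
  (h.orbit hL n 0).mem h.two_le i

/-- The edge closest to a third of the circle is at distance at most `t` from it. -/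
theorem IsPeriodicPolygon.exists_stripMid (h : IsPeriodicPolygon L v t N) (hL : IsCubicSymLam L) :
    ∃ τ e, 0 < τ ∧ τ < 1/6 ∧ IsStripMid L τ e ∧
      ∀ n i, τ ≤ |edgeArc v n i - 1/3| ∧ τ ≤ |edgeArc v n i - 2/3| := by
  let g : ℕ × Fin (r + 1) → ℝ := fun x =>
    min |edgeArc v x.1 x.2 - 1/3| |edgeArc v x.1 x.2 - 2/3|
  obtain ⟨⟨n, i⟩, -, hmin⟩ := Finset.exists_min_image (Finset.range N ×ˢ Finset.univ) g
    ⟨(0, 0), by simpa using Nat.lt_of_lt_of_le one_pos h.N_pos⟩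
  have hmin' : ∀ m j, g (n, i) ≤ g (m, j) := by
    intro m j
    have h1 := hmin (m % N, j) (by simpa using Nat.mod_lt m h.N_pos)
    have h2 : g (m % N, j) = g (m, j) := by
      simp only [g, ← h.edgeArc_mod]
    linarith
  have hne : ∀ k : ℤ, 3 * edgeArc v n i ≠ k := by
    intro k hk
    have := edgeArc_succ v n i
    rw [hk, Int.fract_intCast] at this
    exact (h.edgeArc_pos (n + 1) i).ne' this
  have hpos : 0 < g (n, i) := by
    refine lt_min (abs_pos.2 fun e => hne 1 ?_) (abs_pos.2 fun e => hne 2 ?_)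
    · push_cast; linarith
    · push_cast; linarith
  have hle : g (n, i) ≤ t := by
    refine (hmin' (N - 1) (Fin.last r)).trans ?_
    have h1 := edgeArc_succ v (N - 1) (Fin.last r)
    rw [Nat.sub_add_cancel h.N_pos, h.edgeArc_mod, Nat.mod_self] at h1
    have h2 : edgeArc v 0 (Fin.last r) = 1 - 3 * t := by
      unfold edgeArc
      rw [Fin.last_add_one]
      exact (posArc_swap fun e => h.ne_last (h.inj e)).trans (by rw [h.length])
    have h3 := h.bound (N - 1)
    have h4 : edgeArc v (N - 1) (Fin.last r) =
        1 - posArc (s3^[N - 1] (v 0)) (s3^[N - 1] (v (Fin.last r))) := by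
      unfold edgeArc
      rw [Fin.last_add_one]
      exact posArc_swap fun e => h.ne_last (h.iterate_inj _ e)
    have t0 := h.t_pos
    have t1 := h.t_lt
    obtain ⟨h5, h6⟩ := h3
    simp only [g]
    generalize edgeArc v (N - 1) (Fin.last r) = η at *
    rcases fract_three_mul (ω := η) (by linarith) (by linarith) with
      ⟨c1, c2⟩ | ⟨c1, c2, c3⟩ | ⟨c1, c2⟩
    · refine (min_le_left _ _).trans ?_
      rw [abs_of_nonpos (by linarith)]; linarith
    · refine (min_le_right _ _).trans ?_
      rw [abs_of_nonpos (by linarith)]; linarith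
    · linarith
  have hatt : |edgeArc v n i - 1/3| = g (n, i) ∨ |edgeArc v n i - 2/3| = g (n, i) := by
    rcases min_choice |edgeArc v n i - 1/3| |edgeArc v n i - 2/3| with e | e
    · exact Or.inl e.symm
    · exact Or.inr e.symm
  obtain ⟨e, he⟩ := hL.exists_stripMid hpos (by linarith [h.t_lt]) (h.edge_mem hL n i) hatt
  exact ⟨_, e, hpos, by linarith [h.t_lt], he, fun m j => le_min_iff.1 (hmin' m j)⟩

theorem IsPeriodicPolygon.exists_cap (h : IsPeriodicPolygon L v t N) (hL : IsCubicSymLam L)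
    {τ : ℝ} {e : S1} (hτ0 : 0 < τ) (hτ1 : τ < 1/6) (he : IsStripMid L τ e)
    (hτ : ∀ n i, τ ≤ |edgeArc v n i - 1/3| ∧ τ ≤ |edgeArc v n i - 2/3|) (i : Fin (r + 1)) :
    ∃ n ε, InCap (orbitPolygon v n ε) i (s3 e) ∧ ∀ m, edgeArc v n i ≤ edgeArc v m i := by
  obtain ⟨n, -, hmin⟩ := Finset.exists_min_image (Finset.range N) (fun n => edgeArc v (n + 1) i)
    ⟨0, by simpa using Nat.lt_of_lt_of_le one_pos h.N_pos⟩
  have hmin' : ∀ m, edgeArc v (n + 1) i ≤ edgeArc v m i := by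
    intro m
    have h1 := hmin ((m + N - 1) % N) (by simpa using Nat.mod_lt _ h.N_pos)
    have h2 : edgeArc v ((m + N - 1) % N + 1) i = edgeArc v m i := by
      have := h.N_pos
      rw [h.edgeArc_mod, Nat.mod_add_mod, Nat.sub_add_cancel (by omega), Nat.add_mod_right,
        ← h.edgeArc_mod]
    linarith
  have hlong : 1/3 < edgeArc v n i := by
    by_contra hlt
    have h0 := h.edgeArc_pos n i
    have h1 := hmin' n
    have h2 : edgeArc v n i < 1/3 := lt_of_le_of_ne (not_lt.1 hlt) (by
      intro e1
      have := (hτ n i).1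
      rw [e1, sub_self, abs_zero] at this
      linarith)
    rw [edgeArc_succ, Int.fract_eq_self.2 ⟨by linarith, by linarith⟩] at h1
    linarith
  have hc := hL.stripMid_mem_image_arc hτ0 hτ1 he (h.edge_mem hL n i) hlong (hτ n i).1 (hτ n i).2
  simp only [← Function.iterate_succ_apply' s3] at hc
  rcases hc with hc | hc
  · exact ⟨n + 1, 0, hc, hmin'⟩
  · refine ⟨n + 1, 1, ?_, hmin'⟩
    rw [s3_antip] at hc
    unfold InCap
    rw [posArc_orbitPolygon, ← posArc_antip]
    change 0 < posArc (antip (antip (s3^[n + 1] (v i)))) _ ∧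
      posArc (antip (antip (s3^[n + 1] (v i)))) _ < _
    rw [antip_antip]
    exact hc

theorem IsPeriodicPolygon.sum_edgeArc_le (h : IsPeriodicPolygon L v t N) :
    edgeArc v 0 0 + edgeArc v 0 1 + edgeArc v 0 (1 + 1) ≤ 1 := by
  have r2 := h.two_le
  have n1 := Fin.add_one_ne_self r2 0
  have n2 := Fin.add_one_ne_self r2 1
  have n3 := Fin.add_one_add_one_ne_self r2 0
  rw [zero_add] at n1 n3
  have h1 := h.hole (i := 0) (j := 1 + 1) n3
  have h2 := h.hole (i := 1 + 1) (j := 0) n3.symm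
  rw [zero_add] at h1
  have h3 : posArc (v 1) (v (1 + 1)) = _ := posArc_of_le h1
  have h4 := posArc_swap (x := v 0) (y := v (1 + 1)) (fun e => n3 (h.inj e).symm)
  change posArc (v 0) (v (0 + 1)) + posArc (v 1) (v (1 + 1)) +
    posArc (v (1 + 1)) (v (1 + 1 + 1)) ≤ 1
  rw [zero_add]
  linarith

/-- Periodic polygons as above do not exist. -/
theorem IsPeriodicPolygon.false (h : IsPeriodicPolygon L v t N) (hL : IsCubicSymLam L) : False := by
  obtain ⟨τ, e, hτ0, hτ1, he, hτ⟩ := h.exists_stripMid hL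
  have r2 := h.two_le
  have n1 := Fin.add_one_ne_self r2 0
  have n2 := Fin.add_one_ne_self r2 1
  have n3 := Fin.add_one_add_one_ne_self r2 0
  rw [zero_add] at n1 n3
  obtain ⟨m₀, ε₀, c0, l0⟩ := h.exists_cap hL hτ0 hτ1 he hτ 0
  obtain ⟨m₁, ε₁, c1, l1⟩ := h.exists_cap hL hτ0 hτ1 he hτ 1
  obtain ⟨m₂, ε₂, c2, l2⟩ := h.exists_cap hL hτ0 hτ1 he hτ (1 + 1)
  have hsum := h.sum_edgeArc_le
  have p0 := h.edgeArc_pos m₀ 0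
  have p1 := h.edgeArc_pos m₁ 1
  have p2 := h.edgeArc_pos m₂ (1 + 1)
  have q0 := l0 0
  have q1 := l1 0
  have q2 := l2 0
  have key : ∀ {a b c : Fin (r + 1)} {k l m α β γ : ℕ},
      InCap (orbitPolygon v k α) a (s3 e) → InCap (orbitPolygon v l β) b (s3 e) →
      InCap (orbitPolygon v m γ) c (s3 e) → a ≠ b → c ≠ b → a ≠ c →
      (∀ n, edgeArc v k a ≤ edgeArc v n a) → (∀ n, edgeArc v m c ≤ edgeArc v n c) →
      edgeArc v l b ≤ edgeArc v k a → edgeArc v l b ≤ edgeArc v m c →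
      edgeArc v k a + edgeArc v l b < 1 → edgeArc v m c + edgeArc v l b < 1 →
      edgeArc v k a + edgeArc v m c < 1 → False := by
    intro a b c k l m α β γ ha hb hc hab hcb hac mina minc lba lbc sab scb sac
    refine no_three_caps r2 (h.orbit hL k α) (h.orbit hL l β) (h.orbit hL m γ) ha hb hc
      hab hcb hac ?_ ?_ ?_ ?_ ?_ (fun e => hab (h.index_eq hL e.1 e.2))
      (fun e => hcb (h.index_eq hL e.1 e.2)) ?_ ?_ <;> simp only [posArc_orbitPolygon]
    · exact sab
    · exact scb
    · exact sac
    · exact lba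
    · exact lbc
    · exact mina l
    · exact minc l
  rcases le_total (edgeArc v m₀ 0) (edgeArc v m₁ 1) with h01 | h01
  · rcases le_total (edgeArc v m₀ 0) (edgeArc v m₂ (1 + 1)) with h02 | h02
    · exact key c1 c0 c2 n1 n3 n2.symm l1 l2 h01 h02 (by linarith) (by linarith) (by linarith)
    · exact key c1 c2 c0 n2.symm n3.symm n1 l1 l0 (by linarith) h02 (by linarith) (by linarith)
        (by linarith)
  · rcases le_total (edgeArc v m₁ 1) (edgeArc v m₂ (1 + 1)) with h12 | h12
    · exact key c0 c1 c2 n1.symm n2 n3.symm l0 l2 h01 h12 (by linarith) (by linarith)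
        (by linarith)
    · exact key c1 c2 c0 n2.symm n3.symm n1 l1 l0 h12 (by linarith) (by linarith) (by linarith)
        (by linarith)

end

theorem toC_coe (s : ℝ) : toC (s : S1) = Complex.exp ((2 * Real.pi * s : ℝ) * Complex.I) := by
  have h : toC (s : S1) = Complex.exp (2 * Real.pi * Complex.I * ((Int.fract s : ℝ) : ℂ)) := by
    unfold toC
    rw [AddCircle.coe_equivIco_mk_apply]
    simp
  rw [h, Complex.exp_eq_exp_iff_exists_int]
  refine ⟨-⌊s⌋, ?_⟩
  rw [Int.fract]
  push_cast
  ring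

theorem re_toC (s : ℝ) : (toC (s : S1)).re = Real.cos (2 * Real.pi * s) := by
  rw [toC_coe, Complex.exp_ofReal_mul_I_re]

theorem im_toC (s : ℝ) : (toC (s : S1)).im = Real.sin (2 * Real.pi * s) := by
  rw [toC_coe, Complex.exp_ofReal_mul_I_im]

theorem norm_toC (x : S1) : ‖toC x‖ = 1 := by
  obtain ⟨s, rfl⟩ := exists_coe_eq x
  rw [toC_coe, Complex.norm_exp_ofReal_mul_I]

theorem continuous_toC_coe : Continuous fun s : ℝ => toC (s : S1) := by
  simp only [toC_coe]
  fun_prop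

/-- An affine function vanishing on the line through the points of angles `a` and `b`, positive
on the points whose angle is between `a` and `b`. -/
def side (a b : ℝ) (z : ℂ) : ℝ :=
  z.re * Real.cos (Real.pi * (a + b)) + z.im * Real.sin (Real.pi * (a + b)) -
    Real.cos (Real.pi * (b - a))

theorem continuous_side (a b : ℝ) : Continuous (side a b) := by
  unfold side
  have h1 := Complex.continuous_re
  have h2 := Complex.continuous_im
  fun_prop

theorem side_combo (a b : ℝ) {α β : ℝ} (h : α + β = 1) (z w : ℂ) :
    side a b (α • z + β • w) = α * side a b z + β * side a b w := by
  unfold side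
  obtain rfl : β = 1 - α := by linarith
  simp
  ring

theorem side_toC (a b s : ℝ) : side a b (toC (s : S1)) =
    2 * (Real.sin (Real.pi * (s - a)) * Real.sin (Real.pi * (b - s))) := by
  unfold side
  rw [re_toC, im_toC, ← Real.cos_sub, Real.cos_sub_cos]
  rw [show (2 * Real.pi * s - Real.pi * (a + b) + Real.pi * (b - a)) / 2 = Real.pi * (s - a) by ring,
    show (2 * Real.pi * s - Real.pi * (a + b) - Real.pi * (b - a)) / 2 = -(Real.pi * (b - s)) by
      ring, Real.sin_neg]
  ring

theorem sin_pi_mul_pos {x : ℝ} (h0 : 0 < x) (h1 : x < 1) : 0 < Real.sin (Real.pi * x) :=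
  Real.sin_pos_of_pos_of_lt_pi (by positivity) (by nlinarith [Real.pi_pos])

theorem coe_eq_of_sin_eq_zero {a b : ℝ} (h : Real.sin (Real.pi * (b - a)) = 0) :
    (b : S1) = a := by
  obtain ⟨n, hn⟩ := Real.sin_eq_zero_iff.1 h
  have : b = a + n := by
    have := Real.pi_ne_zero
    have : Real.pi * (b - a - n) = 0 := by linarith
    rcases mul_eq_zero.1 this with h | h
    · contradiction
    · linarith
  rw [this, coe_add_int]

theorem side_pos {a b s : ℝ} (h1 : a < s) (h2 : s < b) (h3 : b < a + 1) :
    0 < side a b (toC (s : S1)) := by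
  rw [side_toC]
  have := sin_pi_mul_pos (x := s - a) (by linarith) (by linarith)
  have := sin_pi_mul_pos (x := b - s) (by linarith) (by linarith)
  positivity

theorem side_neg {a b s : ℝ} (h1 : a < b) (h2 : b < s) (h3 : s < a + 1) :
    side a b (toC (s : S1)) < 0 := by
  rw [side_toC]
  have e1 := sin_pi_mul_pos (x := s - a) (by linarith) (by linarith)
  have e2 := sin_pi_mul_pos (x := s - b) (by linarith) (by linarith)
  rw [show Real.pi * (b - s) = -(Real.pi * (s - b)) by ring, Real.sin_neg]
  nlinarith

theorem side_left (a b : ℝ) : side a b (toC (a : S1)) = 0 := by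
  rw [side_toC]; simp

theorem side_right (a b : ℝ) : side a b (toC (b : S1)) = 0 := by
  rw [side_toC]; simp

theorem eq_or_eq_of_side_eq_zero {a b s : ℝ} (h : side a b (toC (s : S1)) = 0) :
    (s : S1) = a ∨ (s : S1) = b := by
  rw [side_toC] at h
  rcases mul_eq_zero.1 ((mul_eq_zero.1 h).resolve_left two_ne_zero) with h | h
  · exact Or.inl (coe_eq_of_sin_eq_zero h)
  · exact Or.inr (coe_eq_of_sin_eq_zero h).symm

theorem exists_eq_mk (ℓ : Chord) : ∃ u v : S1, ℓ = s(u, v) :=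
  Sym2.ind (f := fun ℓ => ∃ u v : S1, ℓ = s(u, v)) (fun u v => ⟨u, v, rfl⟩) ℓ

theorem chordSet_mk (x y : S1) : chordSet s(x, y) = segment ℝ (toC x) (toC y) := rfl

theorem side_eq_zero {a b : ℝ} {z : ℂ} (hz : z ∈ chordSet s((a : S1), (b : S1))) :
    side a b z = 0 := by
  rw [chordSet_mk] at hz
  obtain ⟨α, β, -, -, h, rfl⟩ := hz
  rw [side_combo a b h, side_left, side_right]
  ring

theorem eq_or_eq_of_toC_mem {x y z : S1} (h : toC z ∈ chordSet s(x, y)) : z = x ∨ z = y := by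
  obtain ⟨a, rfl⟩ := exists_coe_eq x
  obtain ⟨b, rfl⟩ := exists_coe_eq y
  obtain ⟨s, rfl⟩ := exists_coe_eq z
  exact eq_or_eq_of_side_eq_zero (side_eq_zero h)

theorem toC_injective : Function.Injective toC := by
  intro x y h
  have : toC x ∈ chordSet s(y, y) := by rw [h, chordSet_mk]; exact left_mem_segment ℝ _ _
  simpa using eq_or_eq_of_toC_mem this

theorem mem_chordSet_of_side_eq_zero {a b : ℝ} (hab : a < b) (hba : b < a + 1) {z : ℂ}
    (hz : ‖z‖ ≤ 1) (h : side a b z = 0) : z ∈ chordSet s((a : S1), (b : S1)) := by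
  have hk := sin_pi_mul_pos (x := b - a) (by linarith) (by linarith)
  have ea : 2 * Real.pi * a = Real.pi * (a + b) - Real.pi * (b - a) := by ring
  have eb : 2 * Real.pi * b = Real.pi * (a + b) + Real.pi * (b - a) := by ring
  have e1 := Real.sin_sq_add_cos_sq (Real.pi * (a + b))
  have e2 := Real.sin_sq_add_cos_sq (Real.pi * (b - a))
  have hre_a := re_toC a
  have him_a := im_toC a
  have hre_b := re_toC b
  have him_b := im_toC b
  rw [ea, Real.cos_sub] at hre_a
  rw [ea, Real.sin_sub] at him_a
  rw [eb, Real.cos_add] at hre_b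
  rw [eb, Real.sin_add] at him_b
  have hn : z.re ^ 2 + z.im ^ 2 ≤ 1 := by
    have := Complex.sq_norm z
    rw [Complex.normSq_apply] at this
    nlinarith [norm_nonneg z]
  unfold side at h
  generalize Real.cos (Real.pi * (a + b)) = c at *
  generalize Real.sin (Real.pi * (a + b)) = s at *
  generalize Real.cos (Real.pi * (b - a)) = p at *
  generalize Real.sin (Real.pi * (b - a)) = k at *
  set y := z.im * c - z.re * s with hy
  have hxre : z.re = p * c - y * s := by
    have : p = z.re * c + z.im * s := by linarith
    rw [this, hy]; linear_combination (-z.re) * e1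
  have hxim : z.im = p * s + y * c := by
    have : p = z.re * c + z.im * s := by linarith
    rw [this, hy]; linear_combination (-z.im) * e1
  have hyk : y ^ 2 ≤ k ^ 2 := by
    have : z.re ^ 2 + z.im ^ 2 = p ^ 2 + y ^ 2 := by
      rw [hxre, hxim]; linear_combination (p ^ 2 + y ^ 2) * e1
    linarith
  obtain ⟨hy1, hy2⟩ := abs_le.1 (abs_le_of_sq_le_sq hyk hk.le)
  rw [chordSet_mk]
  refine ⟨(k - y) / (2 * k), (k + y) / (2 * k), div_nonneg (by linarith) (by linarith),
    div_nonneg (by linarith) (by linarith), by field_simp; ring, ?_⟩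
  apply Complex.ext
  · simp only [Complex.add_re, Complex.real_smul, Complex.re_ofReal_mul, hre_a, hre_b, hxre]
    field_simp
    ring
  · simp only [Complex.add_im, Complex.real_smul, Complex.im_ofReal_mul, him_a, him_b, hxim]
    field_simp
    ring

theorem exists_rep_of_ne {u v : S1} (h : u ≠ v) :
    ∃ a b : ℝ, a < b ∧ b < a + 1 ∧ (a : S1) = u ∧ (b : S1) = v := by
  obtain ⟨a, rfl⟩ := exists_coe_eq u
  refine ⟨a, a + posArc a v, by linarith [posArc_pos.2 h], by linarith [posArc_lt_one (a : S1) v],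
    rfl, ?_⟩
  rw [AddCircle.coe_add, add_posArc]

/-- A chord with endpoints distinct from `s` cuts off an arc around `s`. -/
theorem exists_rep_around {u v : S1} {s : ℝ} (h : u ≠ v) (hu : (s : S1) ≠ u) (hv : (s : S1) ≠ v) :
    ∃ α β : ℝ, α < s ∧ s < β ∧ β < α + 1 ∧ s((α : S1), (β : S1)) = s(u, v) := by
  have key : ∀ {u v : S1}, (s : S1) ≠ u → (s : S1) ≠ v → posArc s v < posArc s u →
      ∃ α β : ℝ, α < s ∧ s < β ∧ β < α + 1 ∧ s((α : S1), (β : S1)) = s(u, v) := by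
    intro u v hu hv h
    refine ⟨s + posArc s u - 1, s + posArc s v, by linarith [posArc_lt_one (s : S1) u],
      by linarith [posArc_pos.2 hv], by linarith, ?_⟩
    rw [← coe_add_one (_ - 1), sub_add_cancel, AddCircle.coe_add, AddCircle.coe_add, add_posArc,
      add_posArc]
  rcases lt_trichotomy (posArc s v) (posArc s u) with h1 | h1 | h1
  · exact key hu hv h1
  · exact absurd (eq_of_posArc_eq h1).symm h
  · rw [Sym2.eq_swap]
    exact key hv hu h1

section

variable {L : Set Chord} {U : Set ℂ}

theorem side_sign (hU : IsPreconnected U) (hUL : U ⊆ openDisk \ unionSet L) {a b : ℝ}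
    (hab : a < b) (hba : b < a + 1) (hl : s((a : S1), (b : S1)) ∈ L) :
    (∀ z ∈ U, 0 < side a b z) ∨ ∀ z ∈ U, side a b z < 0 := by
  have hne : ∀ z ∈ U, side a b z ≠ 0 := by
    intro z hz h0
    have h1 := (hUL hz).1
    rw [openDisk, mem_ball_zero_iff] at h1
    exact (hUL hz).2 (mem_biUnion hl (mem_chordSet_of_side_eq_zero hab hba h1.le h0))
  by_contra! h
  obtain ⟨⟨z, hz, hz0⟩, w, hw, hw0⟩ := h
  obtain ⟨x, hx, hx0⟩ := hU.intermediate_value hz hw (continuous_side a b).continuousOn ⟨hz0, hw0⟩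
  exact hne x hx hx0

theorem side_sign_closure (hU : IsPreconnected U) (hUL : U ⊆ openDisk \ unionSet L) {a b : ℝ}
    (hab : a < b) (hba : b < a + 1) (hl : s((a : S1), (b : S1)) ∈ L) :
    (∀ z ∈ closure U, 0 ≤ side a b z) ∨ ∀ z ∈ closure U, side a b z ≤ 0 := by
  rcases side_sign hU hUL hab hba hl with h | h
  · exact Or.inl fun z hz => closure_minimal (fun z hz => (h z hz).le)
      (isClosed_le continuous_const (continuous_side a b)) hz
  · exact Or.inr fun z hz => closure_minimal (fun z hz => (h z hz).le)
      (isClosed_le (continuous_side a b) continuous_const) hz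

theorem unsep_of_mem_closure (hU : IsPreconnected U) (hUL : U ⊆ openDisk \ unionSet L) {x y : S1}
    (hx : toC x ∈ closure U) (hy : toC y ∈ closure U) : Unsep L x y := by
  intro u v huv ⟨h1, h2, h3⟩
  obtain ⟨a, rfl⟩ := exists_coe_eq u
  have ev : ((a + posArc a v : ℝ) : S1) = v := by rw [AddCircle.coe_add, add_posArc]
  have ex : ((a + posArc a x : ℝ) : S1) = x := by rw [AddCircle.coe_add, add_posArc]
  have ey : ((a + posArc a y : ℝ) : S1) = y := by rw [AddCircle.coe_add, add_posArc]
  have hy1 := posArc_lt_one (a : S1) y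
  rw [← ev] at huv
  rw [← ex] at hx
  rw [← ey] at hy
  have px := side_pos (a := a) (b := a + posArc a v) (s := a + posArc a x) (by linarith)
    (by linarith) (by linarith)
  have py := side_neg (a := a) (b := a + posArc a v) (s := a + posArc a y) (by linarith)
    (by linarith) (by linarith)
  rcases side_sign_closure hU hUL (by linarith) (by linarith) huv with h | h
  · exact absurd (h _ hy) (by linarith)
  · exact absurd (h _ hx) (by linarith)

/-- A point of the circle outside the closure of a complementary component is cut off from
it by a leaf. -/
theorem exists_leaf_around {z : ℂ} (hz : z ∈ openDisk \ unionSet L) {s : ℝ}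
    (hs : toC (s : S1) ∉ closure (connectedComponentIn (openDisk \ unionSet L) z)) :
    ∃ α β : ℝ, α < s ∧ s < β ∧ β < α + 1 ∧ s((α : S1), (β : S1)) ∈ L ∧
      ∀ w ∈ closure (connectedComponentIn (openDisk \ unionSet L) z), side α β w ≤ 0 := by
  have hz1 : ‖z‖ < 1 := by simpa [openDisk] using hz.1
  let f : ℝ → ℂ := fun τ => (1 - τ) • z + τ • toC (s : S1)
  have hf : Continuous f := by fun_prop
  have hball : ∀ τ ∈ Ico (0:ℝ) 1, ‖f τ‖ < 1 := by
    intro τ hτ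
    calc ‖f τ‖ ≤ ‖(1 - τ) • z‖ + ‖τ • toC (s : S1)‖ := norm_add_le _ _
      _ = (1 - τ) * ‖z‖ + τ := by
        rw [norm_smul, norm_smul, norm_toC, Real.norm_of_nonneg (by linarith [hτ.2]),
          Real.norm_of_nonneg hτ.1, mul_one]
      _ < 1 := by nlinarith [hτ.1, hτ.2]
  have hmeet : ∃ τ ∈ Ico (0:ℝ) 1, f τ ∈ unionSet L := by
    by_contra! hno
    have hsub : f '' Ico 0 1 ⊆ connectedComponentIn (openDisk \ unionSet L) z := by
      refine (isPreconnected_Ico.image f hf.continuousOn).subset_connectedComponentIn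
        ⟨0, by simp, by simp [f]⟩ ?_
      rintro _ ⟨τ, hτ, rfl⟩
      exact ⟨by simpa [openDisk] using hball τ hτ, hno τ hτ⟩
    refine hs (closure_mono hsub ?_)
    have h1 : f 1 ∈ closure (f '' Ico 0 1) :=
      image_closure_subset_closure_image hf ⟨1, by rw [closure_Ico (by norm_num)]; simp, rfl⟩
    simpa [f] using h1
  obtain ⟨τ, hτ, hτL⟩ := hmeet
  obtain ⟨ℓ, hℓ, hτℓ⟩ := mem_iUnion₂.1 hτL
  obtain ⟨u, v, rfl⟩ := exists_eq_mk ℓ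
  have huv : u ≠ v := by
    rintro rfl
    rw [chordSet_mk, segment_same, mem_singleton_iff] at hτℓ
    have := hball τ hτ
    rw [hτℓ, norm_toC] at this
    exact lt_irrefl _ this
  have hzU := mem_connectedComponentIn hz
  have hU := isPreconnected_connectedComponentIn (x := z) (F := openDisk \ unionSet L)
  have hUL := connectedComponentIn_subset (openDisk \ unionSet L) z
  have hsuv : (s : S1) ≠ u ∧ (s : S1) ≠ v := by
    obtain ⟨a, b, hab, hba, rfl, rfl⟩ := exists_rep_of_ne huv
    have h0 := side_eq_zero hτℓ
    rw [side_combo a b (by ring)] at h0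
    have h1 : side a b z ≠ 0 := by
      rcases side_sign hU hUL hab hba hℓ with h | h
      · exact (h z hzU).ne'
      · exact (h z hzU).ne
    have h2 : side a b (toC (s : S1)) ≠ 0 := by
      intro h2
      rw [h2, mul_zero, add_zero] at h0
      exact h1 ((mul_eq_zero.1 h0).resolve_left (by linarith [hτ.2]))
    constructor
    · intro h; rw [h, side_left] at h2; exact h2 rfl
    · intro h; rw [h, side_right] at h2; exact h2 rfl
  obtain ⟨α, β, h1, h2, h3, h4⟩ := exists_rep_around huv hsuv.1 hsuv.2
  rw [← h4] at hℓ hτℓ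
  refine ⟨α, β, h1, h2, h3, hℓ, ?_⟩
  have h0 := side_eq_zero hτℓ
  rw [side_combo α β (by ring)] at h0
  have hp := side_pos h1 h2 h3
  have hnp : side α β z ≤ 0 := by
    by_contra! hc
    nlinarith [hτ.1, hτ.2, mul_pos (show 0 < 1 - τ by linarith [hτ.2]) hc,
      mul_nonneg hτ.1 hp.le]
  rcases side_sign hU hUL (by linarith) h3 hℓ with h | h
  · exact absurd (h z hzU) (not_lt.2 hnp)
  · exact fun w hw => closure_minimal (fun z hz => (h z hz).le)
      (isClosed_le (continuous_side α β) continuous_const) hw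

theorem mem_of_consecutive (hL : IsLamination L) {z : ℂ} (hz : z ∈ openDisk \ unionSet L)
    {a b : ℝ} (hab : a < b) (hba : b < a + 1)
    (ha : toC (a : S1) ∈ closure (connectedComponentIn (openDisk \ unionSet L) z))
    (hb : toC (b : S1) ∈ closure (connectedComponentIn (openDisk \ unionSet L) z))
    (hs : ∀ s, a < s → s < b →
      toC (s : S1) ∉ closure (connectedComponentIn (openDisk \ unionSet L) z)) :
    s((a : S1), (b : S1)) ∈ L := by
  have step1 : ∀ s, a < s → s < b →
      ∃ α β : ℝ, a ≤ α ∧ α < s ∧ s < β ∧ β ≤ b ∧ s((α : S1), (β : S1)) ∈ L := by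
    intro s h1 h2
    obtain ⟨α, β, h3, h4, h5, h6, h7⟩ := exists_leaf_around hz (hs s h1 h2)
    refine ⟨α, β, ?_, h3, h4, ?_, h6⟩
    · by_contra! h
      exact absurd (side_pos h (by linarith) h5) (not_lt.2 (h7 _ ha))
    · by_contra! h
      exact absurd (side_pos (by linarith) h h5) (not_lt.2 (h7 _ hb))
  have step2 : ∀ s₁ s₂, a < s₁ → s₁ < s₂ → s₂ < b →
      ∃ α β : ℝ, a ≤ α ∧ α < s₁ ∧ s₂ < β ∧ β ≤ b ∧ s((α : S1), (β : S1)) ∈ L := by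
    intro s₁ s₂ h1 h2 h3
    by_contra! hno
    let T : Set ℝ := {β | ∃ α : ℝ, a ≤ α ∧ α < s₁ ∧ s₁ < β ∧ β ≤ b ∧ s((α : S1), (β : S1)) ∈ L}
    have hT : ∀ β ∈ T, β ≤ s₂ := by
      rintro β ⟨α, e1, e2, e3, e4, e5⟩
      by_contra! h
      exact hno α β e1 e2 h e4 e5
    have hbdd : BddAbove T := ⟨s₂, hT⟩
    obtain ⟨α₀, β₀, e1, e2, e3, e4, e5⟩ := step1 s₁ h1 (by linarith)
    have hβ₀ : β₀ ∈ T := ⟨α₀, e1, e2, e3, e4, e5⟩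
    have hs1 : s₁ < sSup T := lt_of_lt_of_le e3 (le_csSup hbdd hβ₀)
    have hs2 : sSup T ≤ s₂ := csSup_le ⟨_, hβ₀⟩ hT
    obtain ⟨α', β', f1, f2, f3, f4, f5⟩ := step1 (sSup T) (by linarith) (by linarith)
    obtain ⟨β, ⟨α, g1, g2, g3, g4, g5⟩, hβ⟩ := exists_lt_of_lt_csSup ⟨_, hβ₀⟩ f2
    have hβ' : β ≤ sSup T := le_csSup hbdd ⟨α, g1, g2, g3, g4, g5⟩
    rcases lt_or_ge α α' with h | h
    · exact hL.not_mem_of_lt h hβ (by linarith) (by linarith) g5 f5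
    · have := le_csSup hbdd (show β' ∈ T from ⟨α', f1, by linarith, by linarith, f4, f5⟩)
      linarith
  have hmid : (1/2 : ℝ) • toC (a : S1) + (1/2 : ℝ) • toC (b : S1) ∈ unionSet L := by
    have hδ : ∀ n : ℕ, ∃ x : ℝ × ℝ, a ≤ x.1 ∧ x.1 ≤ a + (b - a) / 3 * (1 / ((n : ℝ) + 1)) ∧
        b - (b - a) / 3 * (1 / ((n : ℝ) + 1)) ≤ x.2 ∧ x.2 ≤ b ∧
        s((x.1 : S1), (x.2 : S1)) ∈ L := by
      intro n
      have h1 : (0:ℝ) < 1 / ((n : ℝ) + 1) := by positivity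
      have h2 : 1 / ((n : ℝ) + 1) ≤ 1 := by
        rw [div_le_one (by positivity)]
        linarith [Nat.cast_nonneg (α := ℝ) n]
      have h3 : 0 < (b - a) / 3 * (1 / ((n : ℝ) + 1)) := mul_pos (by linarith) h1
      have h4 : (b - a) / 3 * (1 / ((n : ℝ) + 1)) ≤ (b - a) / 3 :=
        mul_le_of_le_one_right (by linarith) h2
      obtain ⟨α, β, e1, e2, e3, e4, e5⟩ := step2 (a + (b - a) / 3 * (1 / ((n : ℝ) + 1)))
        (b - (b - a) / 3 * (1 / ((n : ℝ) + 1))) (by linarith) (by linarith) (by linarith)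
      exact ⟨(α, β), e1, e2.le, e3.le, e4, e5⟩
    choose x h1 h2 h3 h4 h5 using hδ
    have hlim : Filter.Tendsto (fun n : ℕ => (b - a) / 3 * (1 / ((n : ℝ) + 1))) Filter.atTop
        (nhds 0) := by
      simpa using tendsto_one_div_add_atTop_nhds_zero_nat.const_mul ((b - a) / 3)
    have t1 : Filter.Tendsto (fun n => (x n).1) Filter.atTop (nhds a) :=
      tendsto_of_tendsto_of_tendsto_of_le_of_le tendsto_const_nhds
        (by simpa using hlim.const_add a) h1 h2
    have t2 : Filter.Tendsto (fun n => (x n).2) Filter.atTop (nhds b) :=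
      tendsto_of_tendsto_of_tendsto_of_le_of_le (by simpa using hlim.const_sub b)
        tendsto_const_nhds h3 h4
    refine hL.closed.mem_of_tendsto
      ((((continuous_toC_coe.tendsto a).comp t1).const_smul (1/2 : ℝ)).add
        (((continuous_toC_coe.tendsto b).comp t2).const_smul (1/2 : ℝ)))
      (Filter.Eventually.of_forall fun n => mem_biUnion (h5 n) ?_)
    rw [chordSet_mk]
    exact ⟨1/2, 1/2, by norm_num, by norm_num, by norm_num, rfl⟩
  obtain ⟨ℓ, hℓ, hm⟩ := mem_iUnion₂.1 hmid
  have hne : (a : S1) ≠ b := by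
    intro h
    have h1 := posArc_of_le (u := (a : S1)) (x := a) (y := b)
      (by rw [posArc_self]; exact posArc_nonneg _ _)
    have h2 : posArc (a : S1) b = b - a := by
      rw [posArc_coe, Int.fract_eq_self]; constructor <;> linarith
    rw [← h, posArc_self] at h2
    linarith
  obtain ⟨u, v, rfl⟩ := exists_eq_mk ℓ
  have huv : u ≠ v := by
    rintro rfl
    rw [chordSet_mk, segment_same, mem_singleton_iff] at hm
    have h1 : toC u ∈ chordSet s((a : S1), (b : S1)) := by
      rw [chordSet_mk, ← hm]
      exact ⟨1/2, 1/2, by norm_num, by norm_num, by norm_num, rfl⟩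
    rcases eq_or_eq_of_toC_mem h1 with rfl | rfl
    · refine hne (toC_injective ?_)
      have h3 : (1/2 : ℝ) • (toC (a : S1) - toC (b : S1)) = 0 := by
        have : toC (a : S1) = (1/2 : ℝ) • toC (a : S1) + (1/2 : ℝ) • toC (a : S1) := by
          rw [← add_smul]; norm_num
        rw [smul_sub, sub_eq_zero]
        exact add_left_cancel (this.symm.trans hm.symm)
      exact sub_eq_zero.1 ((smul_eq_zero.1 h3).resolve_left (by norm_num))
    · refine hne (toC_injective ?_)
      have h3 : (1/2 : ℝ) • (toC (a : S1) - toC (b : S1)) = 0 := by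
        have : toC (b : S1) = (1/2 : ℝ) • toC (b : S1) + (1/2 : ℝ) • toC (b : S1) := by
          rw [← add_smul]; norm_num
        rw [smul_sub, sub_eq_zero]
        exact add_right_cancel (hm.trans this)
      exact sub_eq_zero.1 ((smul_eq_zero.1 h3).resolve_left (by norm_num))
  obtain ⟨p, q, hpq, hqp, rfl, rfl⟩ := exists_rep_of_ne huv
  have h0 := side_eq_zero hm
  rw [side_combo p q (by norm_num)] at h0
  have hzero : side p q (toC (a : S1)) = 0 ∧ side p q (toC (b : S1)) = 0 := by
    rcases side_sign_closure isPreconnected_connectedComponentIn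
      (connectedComponentIn_subset _ z) hpq hqp hℓ with h | h
    · have := h _ ha
      have := h _ hb
      constructor <;> linarith
    · have := h _ ha
      have := h _ hb
      constructor <;> linarith
  rcases eq_or_eq_of_side_eq_zero hzero.1 with e1 | e1 <;>
    rcases eq_or_eq_of_side_eq_zero hzero.2 with e2 | e2
  · exact absurd (e1.trans e2.symm) hne
  · rwa [e1, e2]
  · rwa [e1, e2, Sym2.eq_swap]
  · exact absurd (e1.trans e2.symm) hne

/-- The vertices of a finite gap lying in an arc cut off by one of its edges, listed in order. -/
theorem exists_weakPolygon {L : Set Chord} (hL : IsLamination L) {z : ℂ}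
    (hz : z ∈ openDisk \ unionSet L)
    (hfin : (gapVerts (closure (connectedComponentIn (openDisk \ unionSet L) z))).Finite)
    {a t s₀ : ℝ} (hs₀ : 0 < s₀) (hs₀t : s₀ < t) (ht : t < 1)
    (h0 : (a : S1) ∈ gapVerts (closure (connectedComponentIn (openDisk \ unionSet L) z)))
    (h1 : ((a + t : ℝ) : S1) ∈ gapVerts (closure (connectedComponentIn (openDisk \ unionSet L) z)))
    (h2 : ((a + s₀ : ℝ) : S1) ∈
      gapVerts (closure (connectedComponentIn (openDisk \ unionSet L) z)))
    (hl : s((a : S1), ((a + t : ℝ) : S1)) ∈ L) :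
    ∃ r : ℕ, 2 ≤ r ∧ ∃ e : Fin (r + 1) → ℝ, StrictMono e ∧ e 0 = 0 ∧ e (Fin.last r) = t ∧
      (∃ q, e q = s₀) ∧ IsWeakPolygon L fun i => ((a + e i : ℝ) : S1) := by
  set V := gapVerts (closure (connectedComponentIn (openDisk \ unionSet L) z)) with hV
  have hA : {s : ℝ | s ∈ Icc 0 t ∧ ((a + s : ℝ) : S1) ∈ V}.Finite := by
    refine Finite.of_injOn (f := fun s : ℝ => ((a + s : ℝ) : S1)) (t := V) (fun s hs => hs.2) ?_ hfin
    intro x hx y hy hxy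
    have e1 : posArc (a : S1) ((a + x : ℝ) : S1) = x := by
      rw [posArc_coe, add_sub_cancel_left, Int.fract_eq_self]
      constructor <;> linarith [hx.1.1, hx.1.2]
    have e2 : posArc (a : S1) ((a + y : ℝ) : S1) = y := by
      rw [posArc_coe, add_sub_cancel_left, Int.fract_eq_self]
      constructor <;> linarith [hy.1.1, hy.1.2]
    exact e1.symm.trans ((congrArg _ hxy).trans e2)
  set F := hA.toFinset with hF
  have memF : ∀ s, s ∈ F ↔ s ∈ Icc 0 t ∧ ((a + s : ℝ) : S1) ∈ V := by simp [hF]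
  have m0 : (0 : ℝ) ∈ F := (memF 0).2 ⟨⟨le_rfl, by linarith⟩, by simpa using h0⟩
  have m1 : t ∈ F := (memF t).2 ⟨⟨by linarith, le_rfl⟩, h1⟩
  have m2 : s₀ ∈ F := (memF s₀).2 ⟨⟨hs₀.le, hs₀t.le⟩, h2⟩
  have hcard : 3 ≤ F.card := by
    have h3 : ({0, s₀, t} : Finset ℝ).card = 3 :=
      Finset.card_eq_three.2 ⟨0, s₀, t, hs₀.ne, by linarith, hs₀t.ne, rfl⟩
    rw [← h3]
    refine Finset.card_le_card fun x hx => ?_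
    simp only [Finset.mem_insert, Finset.mem_singleton] at hx
    rcases hx with rfl | rfl | rfl <;> assumption
  obtain ⟨r, hr⟩ : ∃ r, F.card = r + 1 := ⟨F.card - 1, by omega⟩
  let e : Fin (r + 1) → ℝ := F.orderEmbOfFin hr
  have he : StrictMono e := (F.orderEmbOfFin hr).strictMono
  have heF : ∀ i, e i ∈ F := F.orderEmbOfFin_mem hr
  have hFe : ∀ s ∈ F, ∃ i, e i = s := by
    intro s hs
    have : s ∈ range (F.orderEmbOfFin hr) := by rw [F.range_orderEmbOfFin hr]; exact hs
    exact this
  have he0 : ∀ i, 0 ≤ e i := fun i => ((memF _).1 (heF i)).1.1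
  have het : ∀ i, e i ≤ t := fun i => ((memF _).1 (heF i)).1.2
  have heV : ∀ i, ((a + e i : ℝ) : S1) ∈ V := fun i => ((memF _).1 (heF i)).2
  have ez : e 0 = 0 := by
    obtain ⟨i, hi⟩ := hFe 0 m0
    exact le_antisymm (hi ▸ he.monotone (Fin.zero_le i)) (he0 0)
  have el : e (Fin.last r) = t := by
    obtain ⟨i, hi⟩ := hFe t m1
    exact le_antisymm (het _) (hi ▸ he.monotone (Fin.le_last i))
  have harc : ∀ i j, posArc ((a + e i : ℝ) : S1) ((a + e j : ℝ) : S1) =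
      if e i ≤ e j then e j - e i else e j - e i + 1 := by
    intro i j
    rw [posArc_coe, add_sub_add_left_eq_sub]
    split_ifs with h
    · rw [Int.fract_eq_self]
      constructor <;> linarith [he0 i, het j]
    · rw [Int.fract_eq_iff]
      refine ⟨by linarith [he0 j, het i], by linarith, -1, by push_cast; ring⟩
  refine ⟨r, by omega, e, he, ez, el, hFe _ m2, fun i j => unsep_of_mem_closure
    isPreconnected_connectedComponentIn (connectedComponentIn_subset _ z) (heV i) (heV j),
    fun i => Or.inr ?_⟩
  rcases eq_or_ne i (Fin.last r) with rfl | hi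
  · rw [Fin.last_add_one]
    refine ⟨by rw [ez, el, add_zero, Sym2.eq_swap]; exact hl, fun j => ?_⟩
    rw [harc, harc, ez, el]
    have := he0 j
    have := het j
    split_ifs <;> rintro ⟨h3, h4⟩ <;> linarith
  · have hlt : i < i + 1 := Fin.lt_add_one_iff.2 (Fin.lt_last_iff_ne_last.2 hi)
    have hgap : ∀ j, ¬ (e i < e j ∧ e j < e (i + 1)) := by
      rintro j ⟨h3, h4⟩
      have h5 := he.lt_iff_lt.1 h3
      have h6 := he.lt_iff_lt.1 h4
      rw [Fin.lt_def] at h5 h6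
      rw [Fin.val_add_one, if_neg hi] at h6
      omega
    have hstep := he hlt
    refine ⟨mem_of_consecutive hL hz (by linarith) (by linarith [he0 i, het (i + 1)]) (heV i)
      (heV (i + 1)) fun s h3 h4 h5 => ?_, fun j => ?_⟩
    · obtain ⟨j, hj⟩ := hFe (s - a) ((memF _).2
        ⟨⟨by linarith [he0 i], by linarith [het (i + 1)]⟩, by rwa [add_sub_cancel]⟩)
      exact hgap j ⟨by linarith, by linarith⟩
    · simp only [harc, if_pos hstep.le]
      have := he0 j
      have := het (i + 1)
      rintro ⟨h3, h4⟩
      split_ifs at h3 h4 with h5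
      · exact hgap j ⟨by linarith, by linarith⟩
      · linarith

theorem exists_coe_of_mem_regionUnder {a t : ℝ} (ht0 : 0 < t) (ht : t < 1) {x : S1}
    (hx : toC x ∈ regionUnder a t) : ∃ s ∈ Icc 0 t, x = ((a + s : ℝ) : S1) := by
  have hconv : Convex ℝ {z | 0 ≤ side a (a + t) z} := by
    intro z hz w hw α β hα hβ h
    simp only [mem_ofPred_eq] at hz hw ⊢
    rw [side_combo _ _ h]
    positivity
  have hsub : arcSet a (a + t) ⊆ {z | 0 ≤ side a (a + t) z} := by
    rintro _ ⟨s, hs, rfl⟩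
    change 0 ≤ side a (a + t) (toC (s : S1))
    rcases hs.1.eq_or_lt with rfl | h1
    · rw [side_left]
    rcases hs.2.eq_or_lt with rfl | h2
    · rw [side_right]
    exact (side_pos h1 h2 (by linarith)).le
  have h := convexHull_min hsub hconv hx
  have hx' : x = ((a + posArc a x : ℝ) : S1) := by rw [AddCircle.coe_add, add_posArc]
  refine ⟨posArc a x, ⟨posArc_nonneg _ _, ?_⟩, hx'⟩
  by_contra! h3
  rw [hx'] at h
  exact absurd (side_neg (a := a) (b := a + t) (by linarith) (by linarith)
    (by linarith [posArc_lt_one (a : S1) x])) (not_lt.2 h)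

theorem chordPeriodic_isPeriodicPt {x y : S1} (h : ChordPeriodic s(x, y)) :
    ∃ p, 1 ≤ p ∧ Function.IsPeriodicPt s3 p x ∧ Function.IsPeriodicPt s3 p y := by
  obtain ⟨p, hp, h⟩ := h
  have h' : s(s3^[p] x, s3^[p] y) = s(x, y) := h
  refine ⟨p + p, by omega, ?_⟩
  unfold Function.IsPeriodicPt Function.IsFixedPt
  rw [Function.iterate_add_apply, Function.iterate_add_apply]
  rcases Sym2.eq_iff.1 h' with ⟨e1, e2⟩ | ⟨e1, e2⟩
  · simp only [e1, e2, and_self]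
  · simp only [e1, e2, and_self]

theorem exists_interior_endpoint {a t : ℝ} {x y : S1} (hxy : x ≠ y)
    (hne : s(x, y) ≠ s((a : S1), ((a + t : ℝ) : S1)))
    (hx : ∃ s ∈ Icc 0 t, x = ((a + s : ℝ) : S1)) (hy : ∃ s ∈ Icc 0 t, y = ((a + s : ℝ) : S1)) :
    ∃ s, 0 < s ∧ s < t ∧ (((a + s : ℝ) : S1) = x ∨ ((a + s : ℝ) : S1) = y) := by
  obtain ⟨s₁, h1, rfl⟩ := hx
  obtain ⟨s₂, h2, rfl⟩ := hy
  by_contra! h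
  have e1 : s₁ = 0 ∨ s₁ = t := by
    by_contra! e
    exact (h s₁ (lt_of_le_of_ne h1.1 e.1.symm) (lt_of_le_of_ne h1.2 e.2)).1 rfl
  have e2 : s₂ = 0 ∨ s₂ = t := by
    by_contra! e
    exact (h s₂ (lt_of_le_of_ne h2.1 e.1.symm) (lt_of_le_of_ne h2.2 e.2)).2 rfl
  rcases e1 with rfl | rfl <;> rcases e2 with rfl | rfl
  · exact hxy rfl
  · exact hne (by rw [add_zero])
  · exact hne (by rw [add_zero, Sym2.eq_swap])
  · exact hxy rfl

theorem coperiodic_comajors_no_common_gap :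
    ∀ (L : Set Chord) (c c' : Chord), IsCubicSymLam L →
      c ∈ CsCL → c' ∈ CsCL → CoPeriodic c → CoPeriodic c' →
      c ∈ L → c' ∈ L → c' ≠ c → Under c' c →
      ¬ ∃ H : Set ℂ, IsGapOf L H ∧ (gapVerts H).Finite ∧
          IsEdgeOf H c ∧ IsEdgeOf H c' := by
  rintro L c c' hL hc - hcp hcp' hcL - hne ⟨a, t, ht0, ht2, htc, rfl, hsub⟩
    ⟨_, ⟨z, hz, rfl⟩, hfin, ⟨hcd, hcf⟩, ⟨hcd', hcf'⟩⟩
  obtain ⟨x, y, rfl⟩ := exists_eq_mk c'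
  have hxy : x ≠ y := hcd'
  have htpos : 0 < t := by
    refine lt_of_le_of_ne ht0 ?_
    rintro rfl
    exact hcd (by rw [add_zero]; rfl)
  have ht6 : t < 1/6 := by
    obtain ⟨L', -, h | h, -⟩ := hc
    · rwa [htc]
    · exact absurd h hcd
  have hK := isClosed_closure (s := connectedComponentIn (openDisk \ unionSet L) z)
    |>.frontier_subset
  set V := gapVerts (closure (connectedComponentIn (openDisk \ unionSet L) z)) with hV
  have aV : (a : S1) ∈ V := hK (hcf (left_mem_segment ℝ _ _))
  have tV : ((a + t : ℝ) : S1) ∈ V := hK (hcf (right_mem_segment ℝ _ _))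
  have xV : x ∈ V := hK (hcf' (left_mem_segment ℝ _ _))
  have yV : y ∈ V := hK (hcf' (right_mem_segment ℝ _ _))
  obtain ⟨s₀, h0, h1, h2⟩ := exists_interior_endpoint hxy hne
    (exists_coe_of_mem_regionUnder htpos (by linarith) (hsub (left_mem_segment ℝ _ _)))
    (exists_coe_of_mem_regionUnder htpos (by linarith) (hsub (right_mem_segment ℝ _ _)))
  have sV : ((a + s₀ : ℝ) : S1) ∈ V := by
    rcases h2 with h | h <;> rw [h] <;> assumption
  obtain ⟨r, hr, e, he, ez, el, ⟨q, hq⟩, hw⟩ :=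
    exists_weakPolygon hL.toIsLamination hz hfin h0 h1 (by linarith) aV tV sV hcL
  let v : Fin (r + 1) → S1 := fun i => s3 ((a + e i : ℝ) : S1)
  have hinj : Function.Injective v := by
    have key : ∀ {i j}, i < j → v i ≠ v j := by
      intro i j hij h
      have h3 := posArc_eq_zero.2 h
      have h4 := he hij
      have h5 : 0 ≤ e i := ez ▸ he.monotone (Fin.zero_le i)
      have h6 : e j ≤ t := el ▸ he.monotone (Fin.le_last j)
      simp only [v, s3_coe, posArc_coe] at h3
      rw [Int.fract_eq_self.2 (by constructor <;> linarith)] at h3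
      linarith
    intro i j h
    rcases lt_trichotomy i j with h3 | h3 | h3
    · exact absurd h (key h3)
    · exact h3
    · exact absurd h.symm (key h3)
  have hv : IsPolygon L v := { hw.s3 hL.toIsInvLam with inj := hinj }
  have v0 : v 0 = s3 (a : S1) := by simp only [v, ez, add_zero]
  have vl : v (Fin.last r) = s3 ((a + t : ℝ) : S1) := by simp only [v, el]
  obtain ⟨p, hp, pa, pt⟩ := chordPeriodic_isPeriodicPt (x := s3 (a : S1))
    (y := s3 ((a + t : ℝ) : S1)) hcp.1
  obtain ⟨p', hp', px, py⟩ := chordPeriodic_isPeriodicPt (x := s3 x) (y := s3 y) hcp'.1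
  have pq : Function.IsPeriodicPt s3 p' (v q) := by
    simp only [v, hq]
    rcases h2 with h | h <;> rw [h] <;> assumption
  have w0 : s3^[p * p'] (v 0) = v 0 := by rw [v0]; exact pa.mul_const p'
  have wl : s3^[p * p'] (v (Fin.last r)) = v (Fin.last r) := by rw [vl]; exact pt.mul_const p'
  have wq : s3^[p * p'] (v q) = v q := pq.const_mul p
  have hq0 : q ≠ 0 := by rintro rfl; linarith
  have hql : q ≠ Fin.last r := by rintro rfl; linarith
  have hper := hv.eq_of_last_edge hr (hv.toIsWeakPolygon.iterate_s3 hL.toIsInvLam (p * p')) w0 wl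
    (q := q) (by rw [wq]; exact hinj.ne hq0) (by rw [wq]; exact hinj.ne hql)
  have hlen : posArc (v 0) (v (Fin.last r)) = 3 * t := by
    rw [v0, vl, s3_coe, s3_coe, posArc_coe, Int.fract_eq_iff]
    exact ⟨by linarith, by linarith, 0, by push_cast; ring⟩
  have hP : IsPeriodicPolygon L v t (p * p') :=
    { hv with
      two_le := hr
      t_pos := htpos
      t_lt := ht6
      length := hlen
      bound := fun n => by rw [v0, vl]; exact comajor_orbit_bound htpos ht6 hc n
      N_pos := Nat.mul_pos hp hp'
      periodic := fun i => congrFun hper i }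
  exact hP.false hL

end
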